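/- arXiv:0809.2230 — 6 statements merged into one kernel-verified Lean document; each statement's English description precedes it below -/
import Mathlib

section
/- Let a ≥ 0 and H > 0 satisfy cosh(H/2) > e^{a/2}, let ξ : [0,a] → ℝ be continuous, and let z ∈ ℂ with Im z ≥ H. Then: (i) every solution ψ of the Loewner ODE driven by ξ on a subinterval [0,c] ⊆ [0,a] with ψ(0) = z satisfies cosh(Im ψ(t)/2) ≥ cosh(Im z/2)·e^{−t/2} for all t ∈ [0,c]; (ii) there is a solution ψ of the Loewner ODE driven by ξ on all of [0,a] with ψ(0) = z, and it satisfies cosh(Im ψ(a)/2) ≥ cosh(H/2)·e^{−a/2}. -/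
open Complex Topology Filter Set

noncomputable section

/-- `cot₂ z = cot(z/2)`. -/
def cot2 (z : ℂ) : ℂ := Complex.cot (z / 2)

/-- A solution of the Loewner ODE driven by `ξ` on the real interval `I`:
a differentiable `ψ : I → ℂ` with `ψ'(t) = cot₂(ψ(t) − ξ(t))` for all `t ∈ I`
(in particular `ψ(t) − ξ(t) ∉ 2πℤ` for all `t ∈ I`). -/
def IsLoewnerSolOn (ξ : ℝ → ℝ) (I : Set ℝ) (ψ : ℝ → ℂ) : Prop :=
  ∀ t ∈ I, (∀ n : ℤ, ψ t - (ξ t : ℂ) ≠ 2 * (Real.pi : ℂ) * (n : ℂ)) ∧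
    HasDerivWithinAt ψ (cot2 (ψ t - (ξ t : ℂ))) I t

theorem normSq_sin (w : ℂ) :
    normSq (Complex.sin w) = Real.sin w.re ^ 2 + Real.sinh w.im ^ 2 := by
  rw [Complex.sin_eq]
  simp only [← ofReal_sin, ← ofReal_cos, ← ofReal_sinh, ← ofReal_cosh, ← ofReal_mul,
    normSq_add_mul_I]
  linear_combination Real.sinh w.im ^ 2 * Real.sin_sq_add_cos_sq w.re +
    Real.sin w.re ^ 2 * Real.cosh_sq w.im

theorem cot_im (w : ℂ) :
    (Complex.cot w).im =
      -(Real.sinh w.im * Real.cosh w.im) / (Real.sin w.re ^ 2 + Real.sinh w.im ^ 2) := by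
  have hs := Complex.sin_eq w
  have hc := Complex.cos_eq w
  simp only [← ofReal_sin, ← ofReal_cos, ← ofReal_sinh, ← ofReal_cosh, ← ofReal_mul] at hs hc
  rw [Complex.cot, div_im, normSq_sin, ← sub_div, hs, hc]
  congr 1
  simp only [add_re, add_im, sub_re, sub_im, mul_re, mul_im, ofReal_re, ofReal_im, I_re, I_im]
  linear_combination
    -(Real.sinh w.im * Real.cosh w.im) * Real.sin_sq_add_cos_sq w.re

/-- The vertical velocity of the Loewner flow, evaluated at a point of height `2 * w.im`,
decreases `cosh p` at most at the rate `cosh p`. -/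
theorem neg_cosh_le_sinh_mul_cot_im {p : ℝ} {w : ℂ}
    (h : Real.sinh p * (Real.sinh w.im * Real.cosh w.im) ≤ Real.cosh p * Real.sinh w.im ^ 2) :
    -Real.cosh p ≤ Real.sinh p * (Complex.cot w).im := by
  have hp := Real.cosh_pos p
  rw [cot_im, neg_div, mul_neg, neg_le_neg_iff, ← mul_div_assoc]
  refine div_le_of_le_mul₀ (by positivity) hp.le (h.trans ?_)
  gcongr
  linarith [sq_nonneg (Real.sin w.re)]

theorem sinh_mul_cosh_le_cosh_mul_sinh {p q : ℝ} (h : p ≤ q) :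
    Real.sinh p * Real.cosh q ≤ Real.cosh p * Real.sinh q := by
  have := Real.sinh_nonneg_iff.2 (sub_nonneg.2 h)
  rw [Real.sinh_sub] at this
  linarith

theorem cosh_mul_exp_le_of_hasDerivWithinAt {c : ℝ} {ψ v : ℝ → ℂ}
    (hψ : ∀ t ∈ Icc 0 c, HasDerivWithinAt ψ (v t) (Icc 0 c) t)
    (hv : ∀ t ∈ Icc 0 c,
      -Real.cosh ((ψ t).im / 2) ≤ Real.sinh ((ψ t).im / 2) * (v t).im)
    {t : ℝ} (ht : t ∈ Icc 0 c) :
    Real.cosh ((ψ 0).im / 2) * Real.exp (-t / 2) ≤ Real.cosh ((ψ t).im / 2) := by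
  have hd : ∀ s ∈ Icc 0 c,
      HasDerivWithinAt (fun s => Real.cosh ((ψ s).im / 2) * Real.exp (s / 2))
        (Real.sinh ((ψ s).im / 2) * ((v s).im / 2) * Real.exp (s / 2) +
          Real.cosh ((ψ s).im / 2) * (Real.exp (s / 2) * (1 / 2))) (Icc 0 c) s := by
    intro s hs
    have him : HasDerivWithinAt (fun s => (ψ s).im) (v s).im (Icc 0 c) s :=
      imCLM.hasFDerivAt.comp_hasDerivWithinAt s (hψ s hs)
    exact (him.div_const 2).cosh.mul ((hasDerivWithinAt_id s _).div_const 2).exp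
  have hmono := monotoneOn_of_hasDerivWithinAt_nonneg (convex_Icc 0 c)
    (fun s hs => (hd s hs).continuousWithinAt)
    (fun s hs => (hd s (interior_subset hs)).mono interior_subset)
    (fun s hs => by
      have := hv s (interior_subset hs)
      have he := Real.exp_pos (s / 2)
      nlinarith)
  have := hmono (left_mem_Icc.2 (ht.1.trans ht.2)) ht ht.1
  simp only [zero_div, Real.exp_zero, mul_one] at this
  rwa [neg_div, Real.exp_neg, ← div_eq_mul_inv, div_le_iff₀ (Real.exp_pos _)]

theorem sinh_sq_le_norm_sin_sq {δ : ℝ} (hδ : 0 ≤ δ) {w : ℂ} (hw : δ ≤ w.im) :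
    Real.sinh δ ^ 2 ≤ ‖Complex.sin w‖ ^ 2 := by
  rw [← normSq_eq_norm_sq, normSq_sin]
  have h0 := Real.sinh_nonneg_iff.2 hδ
  have h1 := Real.sinh_le_sinh.2 hw
  nlinarith [sq_nonneg (Real.sin w.re)]

theorem norm_cot_le {δ : ℝ} (hδ : 0 < δ) {w : ℂ} (hw : δ ≤ w.im) :
    ‖Complex.cot w‖ ≤ 2 + 1 / Real.sinh δ ^ 2 := by
  have hS : 0 < Real.sinh δ ^ 2 := pow_pos (Real.sinh_pos_iff.2 hδ) 2
  have h := sinh_sq_le_norm_sin_sq hδ.le hw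
  have hne : Complex.sin w ≠ 0 := fun h0 => by
    rw [h0] at h
    simp at h
    linarith
  have hcot : Complex.cot w ^ 2 = 1 / Complex.sin w ^ 2 - 1 := by
    rw [Complex.cot, div_pow, Complex.cos_sq']
    field_simp
  have hn : ‖Complex.cot w‖ ^ 2 ≤ 1 / Real.sinh δ ^ 2 + 1 := by
    rw [← norm_pow, hcot]
    refine (norm_sub_le _ _).trans ?_
    rw [norm_div, norm_pow, norm_one]
    gcongr
  nlinarith [sq_nonneg (‖Complex.cot w‖ - 1), norm_nonneg (Complex.cot w)]

theorem hasDerivAt_cot {w : ℂ} (hw : Complex.sin w ≠ 0) :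
    HasDerivAt Complex.cot (-1 / Complex.sin w ^ 2) w := by
  have h := (Complex.hasDerivAt_cos w).div (Complex.hasDerivAt_sin w) hw
  refine h.congr_deriv ?_
  congr 1
  linear_combination -Complex.sin_sq_add_cos_sq w

theorem lipschitzOnWith_cot {δ : ℝ} (hδ : 0 < δ) :
    LipschitzOnWith (1 / Real.sinh δ ^ 2).toNNReal Complex.cot {w | δ ≤ w.im} := by
  have hS : 0 < Real.sinh δ ^ 2 := pow_pos (Real.sinh_pos_iff.2 hδ) 2
  refine (convex_halfSpace_im_ge δ).lipschitzOnWith_of_nnnorm_hasDerivWithin_le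
    (f' := fun w => -1 / Complex.sin w ^ 2) (fun w hw => ?_) (fun w hw => ?_)
  all_goals have h := sinh_sq_le_norm_sin_sq hδ.le hw
  · refine (hasDerivAt_cot fun h0 => ?_).hasDerivWithinAt
    rw [h0] at h
    simp at h
    linarith
  · rw [← NNReal.coe_le_coe, coe_nnnorm, Real.coe_toNNReal _ (by positivity), norm_div, norm_neg,
      norm_one, norm_pow]
    gcongr

/-- The vertical projection of `ℂ` onto the half-plane `δ ≤ Im w`. -/
def clampIm (δ : ℝ) (w : ℂ) : ℂ := ⟨w.re, max w.im δ⟩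

theorem lipschitzWith_clampIm (δ : ℝ) : LipschitzWith 1 (clampIm δ) := by
  refine LipschitzWith.of_dist_le_mul fun u v => ?_
  have h : |max u.im δ - max v.im δ| ≤ |u.im - v.im| := abs_max_sub_max_le_abs _ _ _
  rw [NNReal.coe_one, one_mul, Complex.dist_eq_re_im, Complex.dist_eq_re_im]
  refine Real.sqrt_le_sqrt ?_
  have := sq_le_sq.2 h
  simp only [clampIm]
  linarith

theorem clampIm_div_two_mem {δ : ℝ} (w : ℂ) : clampIm δ w / 2 ∈ {w : ℂ | δ / 2 ≤ w.im} := by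
  have : (clampIm δ w / 2).im = max w.im δ / 2 := by simp [clampIm]
  rw [mem_ofPred_eq, this]
  gcongr
  exact le_max_right _ _

theorem exists_lipschitzWith_cot2_clampIm {δ : ℝ} (hδ : 0 < δ) :
    ∃ K, LipschitzWith K fun w => cot2 (clampIm δ w) := by
  have h2 : LipschitzWith ‖(2⁻¹ : ℂ)‖₊ fun w : ℂ => w / 2 :=
    LipschitzWith.of_dist_le_mul fun u v => by
      rw [dist_eq_norm, dist_eq_norm, ← sub_div, div_eq_inv_mul, norm_mul, coe_nnnorm]
  have h := (lipschitzOnWith_cot (half_pos hδ)).comp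
    (h2.comp (lipschitzWith_clampIm δ)).lipschitzOnWith (s := univ) fun w _ => clampIm_div_two_mem w
  exact ⟨_, lipschitzOnWith_univ.1 h⟩

/-- The Loewner equation with the field frozen below height `δ` is globally solvable. -/
theorem exists_hasDerivWithinAt_cot2_clampIm {a δ : ℝ} (ha : 0 ≤ a) (hδ : 0 < δ) {ξ : ℝ → ℝ}
    (hξ : ContinuousOn ξ (Icc 0 a)) (z : ℂ) :
    ∃ ψ : ℝ → ℂ, ψ 0 = z ∧ ∀ t ∈ Icc 0 a,
      HasDerivWithinAt ψ (cot2 (clampIm δ (ψ t - ξ t))) (Icc 0 a) t := by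
  obtain ⟨K, hK⟩ := exists_lipschitzWith_cot2_clampIm hδ
  set L : NNReal := (2 + 1 / Real.sinh (δ / 2) ^ 2).toNNReal with hL
  have hPL : IsPicardLindelof (fun t w => cot2 (clampIm δ (w - ξ t)))
      (⟨0, left_mem_Icc.2 ha⟩ : Icc 0 a) z (L * a.toNNReal) 0 L K :=
    { lipschitzOnWith := fun t _ => by
        simpa [Function.comp_def] using (hK.comp (LipschitzWith.id.sub
          (LipschitzWith.const (ξ t : ℂ)))).lipschitzOnWith
      continuousOn := fun x _ => hK.continuous.comp_continuousOn
        (continuousOn_const.sub (continuous_ofReal.comp_continuousOn hξ))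
      norm_le := fun t _ x _ => by
        rw [hL, Real.coe_toNNReal _ (by positivity)]
        exact norm_cot_le (half_pos hδ) (clampIm_div_two_mem _)
      mul_max_le := by simp [ha] }
  exact hPL.exists_eq_forall_mem_Icc_hasDerivWithinAt₀

theorem neg_cosh_le_sinh_mul_cot2_clampIm_im {δ : ℝ} (hδ : 0 < δ) (w : ℂ) (x : ℝ) :
    -Real.cosh (w.im / 2) ≤ Real.sinh (w.im / 2) * (cot2 (clampIm δ (w - x))).im := by
  have him : (clampIm δ (w - x) / 2).im = max w.im δ / 2 := by simp [clampIm]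
  refine neg_cosh_le_sinh_mul_cot_im ?_
  rw [him]
  have h := sinh_mul_cosh_le_cosh_mul_sinh
    (div_le_div_of_nonneg_right (le_max_left w.im δ) zero_le_two)
  have h0 : 0 ≤ Real.sinh (max w.im δ / 2) :=
    Real.sinh_nonneg_iff.2 (half_pos (hδ.trans_le (le_max_right _ _))).le
  nlinarith

theorem neg_cosh_le_sinh_mul_cot2_im (w : ℂ) (x : ℝ) :
    -Real.cosh (w.im / 2) ≤ Real.sinh (w.im / 2) * (cot2 (w - x)).im := by
  have him : ((w - x) / 2).im = w.im / 2 := by simp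
  refine neg_cosh_le_sinh_mul_cot_im ?_
  rw [him]
  exact le_of_eq (by ring)

/-- A continuous function that is positive at the left endpoint and stays away from `(-δ, δ)`
stays above `δ`. -/
theorem le_of_le_abs_of_continuousOn {a δ : ℝ} (hδ : 0 < δ) {y : ℝ → ℝ}
    (hy : ContinuousOn y (Icc 0 a)) (h0 : 0 < y 0) (h : ∀ t ∈ Icc 0 a, δ ≤ |y t|)
    {t : ℝ} (ht : t ∈ Icc 0 a) : δ ≤ y t := by
  by_contra! hlt
  have hneg : y t ≤ 0 := by
    by_contra! hpos
    have := h t ht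
    rw [abs_of_pos hpos] at this
    linarith
  obtain ⟨s, hs, hs0⟩ := intermediate_value_Icc' ht.1 (hy.mono (Icc_subset_Icc_right ht.2))
    ⟨hneg, h0.le⟩
  have := h s ⟨hs.1, hs.2.trans ht.2⟩
  rw [hs0, abs_zero] at this
  linarith

/-- Let `a ≥ 0`, `H > 0` with `cosh(H/2) > e^{a/2}`, `ξ` continuous on `[0,a]`,
and `z ∈ ℂ` with `Im z ≥ H`. Then (i) every solution of the Loewner ODE driven by `ξ` on a
subinterval `[0,c] ⊆ [0,a]` starting at `z` satisfies
`cosh(Im ψ(t)/2) ≥ cosh(Im z/2)·e^{−t/2}` on `[0,c]`; and (ii) there is a solution on all of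
`[0,a]` starting at `z`, and it satisfies `cosh(Im ψ(a)/2) ≥ cosh(H/2)·e^{−a/2}`. -/
theorem loewner_height_bound (a H : ℝ) (ha : 0 ≤ a) (hH : 0 < H)
    (hcosh : Real.exp (a / 2) < Real.cosh (H / 2))
    (ξ : ℝ → ℝ) (hξ : ContinuousOn ξ (Set.Icc 0 a))
    (z : ℂ) (hz : H ≤ z.im) :
    (∀ c ∈ Set.Icc 0 a, ∀ ψ : ℝ → ℂ,
      IsLoewnerSolOn ξ (Set.Icc 0 c) ψ → ψ 0 = z →
      ∀ t ∈ Set.Icc 0 c,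
        Real.cosh (z.im / 2) * Real.exp (-t / 2) ≤ Real.cosh ((ψ t).im / 2)) ∧
    (∃ ψ : ℝ → ℂ, IsLoewnerSolOn ξ (Set.Icc 0 a) ψ ∧ ψ 0 = z ∧
      Real.cosh (H / 2) * Real.exp (-a / 2) ≤ Real.cosh ((ψ a).im / 2)) := by
  refine ⟨fun c _ ψ hψ h0 t ht => ?_, ?_⟩
  · rw [← h0]
    exact cosh_mul_exp_le_of_hasDerivWithinAt (fun s hs => (hψ s hs).2)
      (fun s _ => neg_cosh_le_sinh_mul_cot2_im (ψ s) (ξ s)) ht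
  have hM : 1 < Real.cosh (H / 2) * Real.exp (-a / 2) := by
    rwa [neg_div, Real.exp_neg, ← div_eq_mul_inv, one_lt_div (Real.exp_pos _)]
  obtain ⟨δ, hδ, hcδ⟩ : ∃ δ, 0 < δ ∧ Real.cosh (δ / 2) = Real.cosh (H / 2) * Real.exp (-a / 2) :=
    ⟨2 * Real.arcosh (Real.cosh (H / 2) * Real.exp (-a / 2)),
      mul_pos two_pos (Real.arcosh_pos hM), by
      rw [mul_div_cancel_left₀ _ two_ne_zero, Real.cosh_arcosh hM.le]⟩
  obtain ⟨ψ, h0, hψ⟩ := exists_hasDerivWithinAt_cot2_clampIm ha hδ hξ z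
  have hzim : 0 < z.im := hH.trans_le hz
  have hbound : ∀ t ∈ Icc 0 a, Real.cosh (δ / 2) ≤ Real.cosh ((ψ t).im / 2) := by
    intro t ht
    refine le_trans ?_ (cosh_mul_exp_le_of_hasDerivWithinAt hψ
      (fun s _ => neg_cosh_le_sinh_mul_cot2_clampIm_im hδ (ψ s) (ξ s)) ht)
    rw [hcδ, h0]
    have hcosh_le : Real.cosh (H / 2) ≤ Real.cosh (z.im / 2) := by
      rw [Real.cosh_le_cosh, abs_of_pos (half_pos hH), abs_of_pos (half_pos hzim)]
      linarith
    have := ht.2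
    gcongr
  have him : ∀ t ∈ Icc 0 a, δ ≤ (ψ t).im := fun t ht =>
    le_of_le_abs_of_continuousOn hδ
      (continuous_im.comp_continuousOn fun s hs => (hψ s hs).continuousWithinAt)
      (by rwa [Function.comp_apply, h0])
      (fun s hs => by
        have := Real.cosh_le_cosh.1 (hbound s hs)
        rw [abs_of_pos (half_pos hδ), abs_div, abs_two] at this
        exact (div_le_div_iff_of_pos_right two_pos).1 this) ht
  refine ⟨ψ, fun t ht => ⟨fun n hn => ?_, ?_⟩, h0, hcδ ▸ hbound a (right_mem_Icc.2 ha)⟩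
  · have := congrArg Complex.im hn
    simp at this
    linarith [him t ht]
  · have hclamp : clampIm δ (ψ t - ξ t) = ψ t - ξ t := by
      apply Complex.ext <;> simp [clampIm, him t ht]
    simpa only [hclamp] using hψ t ht
end
end

section
/- Let t ∈ ℝ, let ξ : (−∞,t] → ℝ be continuous, let z ∈ ℂ, and let ψ : (−∞,t] → ℂ be a solution of the Loewner ODE driven by ξ such that Im ψ(s) > 0 for all s ≤ t and ψ(s) − (z − is) → 0 as s → −∞. Then e^{Im z}/4 ≥ e^t·sinh(Im ψ(t)/2)². -/
open Complex Topology Filter Set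

noncomputable section

/-- In the upper half plane, `sinh(Im w) · cosh(Im w) · Im (cot w) ≤ -sinh²(Im w)`. -/
theorem sinh_mul_cosh_mul_im_cot_le (w : ℂ) (hw : 0 < w.im) :
    Real.sinh w.im * Real.cosh w.im * (Complex.cot w).im ≤ -Real.sinh w.im ^ 2 := by
  obtain ⟨a, b⟩ := w
  change 0 < b at hw
  change Real.sinh b * Real.cosh b * (Complex.cot ⟨a, b⟩).im ≤ -Real.sinh b ^ 2
  have hsin : Complex.sin ⟨a, b⟩ =
      ⟨Real.sin a * Real.cosh b, Real.cos a * Real.sinh b⟩ := by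
    rw [Complex.mk_eq_add_mul_I, Complex.sin_add_mul_I, Complex.mk_eq_add_mul_I]
    push_cast
    ring
  have hcos : Complex.cos ⟨a, b⟩ =
      ⟨Real.cos a * Real.cosh b, -(Real.sin a * Real.sinh b)⟩ := by
    rw [Complex.mk_eq_add_mul_I, Complex.cos_add_mul_I, Complex.mk_eq_add_mul_I]
    push_cast
    ring
  have hb : 0 < Real.sinh b := Real.sinh_pos_iff.mpr hw
  have htrig := Real.sin_sq_add_cos_sq a
  have hhyp := Real.cosh_sq b
  have hnorm : Complex.normSq (Complex.sin ⟨a, b⟩) = Real.cosh b ^ 2 - Real.cos a ^ 2 := by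
    rw [hsin, Complex.normSq_mk]
    linear_combination Real.cosh b ^ 2 * htrig - Real.cos a ^ 2 * hhyp
  have hpos : 0 < Real.cosh b ^ 2 - Real.cos a ^ 2 := by
    nlinarith [sq_nonneg (Real.sin a), pow_pos hb 2]
  have him : (Complex.cot ⟨a, b⟩).im =
      -(Real.sinh b * Real.cosh b) / (Real.cosh b ^ 2 - Real.cos a ^ 2) := by
    rw [Complex.cot, Complex.div_im, hnorm, hsin, hcos, ← sub_div]
    congr 1
    linear_combination -(Real.sinh b * Real.cosh b) * htrig
  rw [him, mul_div_assoc', div_le_iff₀ hpos]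
  nlinarith [mul_nonneg (sq_nonneg (Real.sinh b)) (sq_nonneg (Real.cos a))]

/-- Along a Loewner solution in the upper half plane, `e^s · sinh²(Im ψ(s)/2)` is nonincreasing. -/
theorem IsLoewnerSolOn.antitoneOn_exp_mul_sinh_sq {t : ℝ} {ξ : ℝ → ℝ} {ψ : ℝ → ℂ}
    (hψ : IsLoewnerSolOn ξ (Iic t) ψ) (him : ∀ s ∈ Iic t, 0 < (ψ s).im) :
    AntitoneOn (fun s => Real.exp s * Real.sinh ((ψ s).im / 2) ^ 2) (Iic t) := by
  have hderiv : ∀ s ∈ Iic t, HasDerivWithinAt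
      (fun s => Real.exp s * Real.sinh ((ψ s).im / 2) ^ 2)
      (Real.exp s * (Real.sinh ((ψ s).im / 2) ^ 2 +
        Real.sinh ((ψ s).im / 2) * Real.cosh ((ψ s).im / 2) * (cot2 (ψ s - ξ s)).im))
      (Iic t) s := by
    intro s hs
    have himψ : HasDerivWithinAt (fun s => (ψ s).im) (cot2 (ψ s - ξ s)).im (Iic t) s :=
      Complex.imCLM.hasFDerivAt.comp_hasDerivWithinAt s (hψ s hs).2
    refine ((Real.hasDerivAt_exp s).hasDerivWithinAt.mul
      ((himψ.div_const 2).sinh.pow 2)).congr_deriv ?_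
    simp only [Pi.pow_apply]
    push_cast
    ring
  refine antitoneOn_of_hasDerivWithinAt_nonpos (convex_Iic t)
    (fun s hs => (hderiv s hs).continuousWithinAt)
    (fun s hs => (hderiv s (interior_subset hs)).mono interior_subset) fun s hs => ?_
  have hw : ((ψ s - ξ s) / 2).im = (ψ s).im / 2 := by simp
  have hcot := sinh_mul_cosh_mul_im_cot_le ((ψ s - ξ s) / 2)
    (by rw [hw]; exact half_pos (him s (interior_subset hs)))
  rw [hw] at hcot
  exact mul_nonpos_of_nonneg_of_nonpos (Real.exp_pos s).le (by unfold cot2; linarith)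

theorem Real.sinh_half_sq_le_exp_div_four {y : ℝ} (hy : 0 ≤ y) :
    Real.sinh (y / 2) ^ 2 ≤ Real.exp y / 4 := by
  have hsinh : 0 ≤ Real.sinh (y / 2) := Real.sinh_nonneg_iff.mpr (by linarith)
  have hle : Real.sinh (y / 2) ≤ Real.exp (y / 2) / 2 := by
    rw [Real.sinh_eq]
    linarith [Real.exp_pos (-(y / 2))]
  calc Real.sinh (y / 2) ^ 2 ≤ (Real.exp (y / 2) / 2) ^ 2 := pow_le_pow_left₀ hsinh hle 2
    _ = Real.exp y / 4 := by
      rw [div_pow, ← Real.exp_nat_mul]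
      norm_num
      ring_nf

/-- If `ψ` solves the Loewner ODE driven by a continuous `ξ` on `(−∞,t]` with
`Im ψ > 0` throughout and `ψ(s) − (z − is) → 0` as `s → −∞`, then
`e^{Im z}/4 ≥ e^t·sinh(Im ψ(t)/2)²`. -/
theorem loewner_sinh_initial_bound (t : ℝ)
    (ξ : ℝ → ℝ) (hξ : ContinuousOn ξ (Set.Iic t))
    (z : ℂ) (ψ : ℝ → ℂ) (hψ : IsLoewnerSolOn ξ (Set.Iic t) ψ)
    (him : ∀ s ∈ Set.Iic t, 0 < (ψ s).im)
    (hlim : Filter.Tendsto (fun s : ℝ => ψ s - (z - Complex.I * (s : ℂ)))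
      Filter.atBot (𝓝 0)) :
    Real.exp t * Real.sinh ((ψ t).im / 2) ^ 2 ≤ Real.exp z.im / 4 := by
  have hsum : Tendsto (fun s : ℝ => s + (ψ s).im) atBot (𝓝 z.im) := by
    have h := ((Complex.continuous_im.tendsto 0).comp hlim).add_const z.im
    simp only [Complex.zero_im, zero_add] at h
    refine h.congr fun s => ?_
    simp
    ring
  refine ge_of_tendsto (((Real.continuous_exp.tendsto _).comp hsum).div_const 4) ?_
  filter_upwards [eventually_le_atBot t] with s hs
  calc Real.exp t * Real.sinh ((ψ t).im / 2) ^ 2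
      ≤ Real.exp s * Real.sinh ((ψ s).im / 2) ^ 2 :=
        hψ.antitoneOn_exp_mul_sinh_sq him hs self_mem_Iic hs
    _ ≤ Real.exp s * (Real.exp (ψ s).im / 4) :=
        mul_le_mul_of_nonneg_left (Real.sinh_half_sq_le_exp_div_four (him s hs).le)
          (Real.exp_pos s).le
    _ = Real.exp (s + (ψ s).im) / 4 := by rw [Real.exp_add, mul_div_assoc]
end
end

section
/- There exist nonincreasing functions S₁, S₂ : (0,∞) → (0,∞) with S_j(h) = O(h·e^{−h}) as h → ∞ (j = 1, 2) such that the following holds: for every h > 0 and every harmonic function J on {z ∈ ℂ : |Im z| < h} satisfying J(conj(z)) = −J(z) for all z, J > 0 on S_h, and J(z + 2π) = J(z) for all z, one has |∂_x∂_y J(x)| ≤ S₁(h)·∂_y J(x) and |∂_x²∂_y J(x)| ≤ S₂(h)·∂_y J(x) for every x ∈ ℝ. -/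
open Complex Topology Filter Set

noncomputable section

/-- Partial derivative in the real (horizontal) direction. -/
def pdx (J : ℂ → ℝ) (z : ℂ) : ℝ := deriv (fun x : ℝ => J (z + (x : ℂ))) 0

/-- Partial derivative in the imaginary (vertical) direction. -/
def pdy (J : ℂ → ℝ) (z : ℂ) : ℝ := deriv (fun y : ℝ => J (z + (y : ℂ) * Complex.I)) 0

/-- A real-valued function is harmonic on an open set if it is C² there with
vanishing Laplacian. -/
def IsHarmonicOn (J : ℂ → ℝ) (U : Set ℂ) : Prop :=
  ContDiffOn ℝ 2 J U ∧ ∀ z ∈ U, pdx (pdx J) z + pdy (pdy J) z = 0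

/-- The complex gradient `∂_y J + i ∂_x J`, holomorphic when `J` is harmonic. -/
def vertGrad (J : ℂ → ℝ) (z : ℂ) : ℂ := (pdy J z : ℂ) + (pdx J z : ℂ) * I

theorem isOpen_strip (h : ℝ) : IsOpen {z : ℂ | |z.im| < h} :=
  isOpen_lt (by fun_prop) continuous_const

theorem hasDerivAt_add_ofReal (z : ℂ) (t : ℝ) :
    HasDerivAt (fun x : ℝ => z + (x : ℂ)) 1 t := by
  simpa using (hasDerivAt_id t).ofReal_comp.const_add z

theorem hasDerivAt_add_ofReal_mul_I (z : ℂ) (t : ℝ) :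
    HasDerivAt (fun y : ℝ => z + (y : ℂ) * I) I t := by
  simpa using ((hasDerivAt_id t).ofReal_comp.mul_const I).const_add z

theorem pdx_eq_fderiv {J : ℂ → ℝ} {z : ℂ} (hJ : DifferentiableAt ℝ J z) :
    pdx J z = fderiv ℝ J z 1 := by
  have hJ' : HasFDerivAt J (fderiv ℝ J z) (z + ((0 : ℝ) : ℂ)) := by simpa using hJ.hasFDerivAt
  exact (hJ'.comp_hasDerivAt 0 (hasDerivAt_add_ofReal z 0)).deriv

theorem pdy_eq_fderiv {J : ℂ → ℝ} {z : ℂ} (hJ : DifferentiableAt ℝ J z) :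
    pdy J z = fderiv ℝ J z I := by
  have hJ' : HasFDerivAt J (fderiv ℝ J z) (z + ((0 : ℝ) : ℂ) * I) := by
    simpa using hJ.hasFDerivAt
  exact (hJ'.comp_hasDerivAt 0 (hasDerivAt_add_ofReal_mul_I z 0)).deriv

theorem pdx_congr {J K : ℂ → ℝ} {z : ℂ} (h : J =ᶠ[𝓝 z] K) : pdx J z = pdx K z := by
  refine EventuallyEq.deriv_eq ?_
  have hc : Tendsto (fun x : ℝ => z + (x : ℂ)) (𝓝 0) (𝓝 z) := by
    simpa using (hasDerivAt_add_ofReal z 0).continuousAt.tendsto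
  exact hc.eventually h

theorem pdy_congr {J K : ℂ → ℝ} {z : ℂ} (h : J =ᶠ[𝓝 z] K) : pdy J z = pdy K z := by
  refine EventuallyEq.deriv_eq ?_
  have hc : Tendsto (fun y : ℝ => z + (y : ℂ) * I) (𝓝 0) (𝓝 z) := by
    simpa using (hasDerivAt_add_ofReal_mul_I z 0).continuousAt.tendsto
  exact hc.eventually h

theorem pdx_re {F : ℂ → ℂ} {z : ℂ} (hF : DifferentiableAt ℂ F z) :
    pdx (fun w => (F w).re) z = (deriv F z).re := by
  have h := (reCLM.hasFDerivAt (x := F z)).comp z hF.hasDerivAt.complexToReal_fderiv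
  change HasFDerivAt (fun w => (F w).re) _ z at h
  rw [pdx_eq_fderiv h.differentiableAt, h.fderiv]
  simp

theorem pdy_re {F : ℂ → ℂ} {z : ℂ} (hF : DifferentiableAt ℂ F z) :
    pdy (fun w => (F w).re) z = -(deriv F z).im := by
  have h := (reCLM.hasFDerivAt (x := F z)).comp z hF.hasDerivAt.complexToReal_fderiv
  change HasFDerivAt (fun w => (F w).re) _ z at h
  rw [pdy_eq_fderiv h.differentiableAt, h.fderiv]
  simp

theorem IsHarmonicOn.harmonicOnNhd {J : ℂ → ℝ} {U : Set ℂ} (hU : IsOpen U)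
    (hJ : IsHarmonicOn J U) : InnerProductSpace.HarmonicOnNhd J U := by
  have hC : ∀ z ∈ U, ContDiffAt ℝ 2 J z := fun z hz => hJ.1.contDiffAt (hU.mem_nhds hz)
  have hd : ∀ z ∈ U, DifferentiableAt ℝ J z := fun z hz => (hC z hz).differentiableAt (by norm_num)
  refine fun z hz => ⟨hC z hz, ?_⟩
  filter_upwards [hU.mem_nhds hz] with w hw
  have hd2 : DifferentiableAt ℝ (fderiv ℝ J) w :=
    ((hC w hw).fderiv_right (m := 1) (by norm_num)).differentiableAt (by norm_num)
  have hx : pdx J =ᶠ[𝓝 w] fun v => fderiv ℝ J v 1 := by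
    filter_upwards [hU.mem_nhds hw] with v hv using pdx_eq_fderiv (hd v hv)
  have hy : pdy J =ᶠ[𝓝 w] fun v => fderiv ℝ J v I := by
    filter_upwards [hU.mem_nhds hw] with v hv using pdy_eq_fderiv (hd v hv)
  have key := hJ.2 w hw
  rw [pdx_congr hx, pdy_congr hy, pdx_eq_fderiv (hd2.clm_apply (differentiableAt_const _)),
    pdy_eq_fderiv (hd2.clm_apply (differentiableAt_const _)),
    fderiv_clm_apply hd2 (differentiableAt_const _),
    fderiv_clm_apply hd2 (differentiableAt_const _)] at key
  rw [InnerProductSpace.laplacian_eq_iteratedFDeriv_complexPlane]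
  simpa [iteratedFDeriv_two_apply] using key

/-- If `J` is the real part of a holomorphic `F`, then `vertGrad J` is `i` times the derivative of `F`. -/
theorem vertGrad_eq_I_mul_deriv {J : ℂ → ℝ} {F : ℂ → ℂ} {U : Set ℂ} (hU : IsOpen U)
    (hF : DifferentiableOn ℂ F U) (hJF : U.EqOn (fun w => (F w).re) J) {z : ℂ} (hz : z ∈ U) :
    vertGrad J z = I * deriv F z := by
  have hFz := hF.differentiableAt (hU.mem_nhds hz)
  have hJ : J =ᶠ[𝓝 z] fun w => (F w).re := by
    filter_upwards [hU.mem_nhds hz] with w hw using (hJF hw).symm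
  rw [vertGrad, pdx_congr hJ, pdy_congr hJ, pdx_re hFz, pdy_re hFz]
  apply Complex.ext <;> simp

theorem differentiableOn_vertGrad {J : ℂ → ℝ} {U : Set ℂ} (hU : IsOpen U)
    (hJ : IsHarmonicOn J U) : DifferentiableOn ℂ (vertGrad J) U := by
  intro z hz
  obtain ⟨r, hr, hrU⟩ := Metric.isOpen_iff.1 hU z hz
  obtain ⟨F, hF, hJF⟩ :=
    InnerProductSpace.HarmonicOnNhd.exists_analyticOnNhd_ball_re_eq
      (fun w hw => hJ.harmonicOnNhd hU w (hrU hw))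
  have hF' : DifferentiableOn ℂ (fun w => I * deriv F w) (Metric.ball z r) :=
    (hF.differentiableOn.deriv Metric.isOpen_ball).const_mul I
  refine (((hF'.differentiableAt (Metric.ball_mem_nhds z hr)).congr_of_eventuallyEq
    ?_)).differentiableWithinAt
  filter_upwards [Metric.ball_mem_nhds z hr] with w hw using
    vertGrad_eq_I_mul_deriv Metric.isOpen_ball hF.differentiableOn hJF hw

theorem re_vertGrad (J : ℂ → ℝ) (z : ℂ) : (vertGrad J z).re = pdy J z := by
  simp [vertGrad]

theorem pdx_pdy_eq {J : ℂ → ℝ} {U : Set ℂ} (hU : IsOpen U) (hJ : IsHarmonicOn J U) {z : ℂ}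
    (hz : z ∈ U) : pdx (pdy J) z = (deriv (vertGrad J) z).re := by
  rw [← pdx_re ((differentiableOn_vertGrad hU hJ).differentiableAt (hU.mem_nhds hz))]
  simp only [re_vertGrad]

theorem pdx_pdx_pdy_eq {J : ℂ → ℝ} {U : Set ℂ} (hU : IsOpen U) (hJ : IsHarmonicOn J U) {z : ℂ}
    (hz : z ∈ U) : pdx (pdx (pdy J)) z = (deriv (deriv (vertGrad J)) z).re := by
  rw [← pdx_re (((differentiableOn_vertGrad hU hJ).deriv hU).differentiableAt (hU.mem_nhds hz))]
  refine pdx_congr ?_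
  filter_upwards [hU.mem_nhds hz] with w hw using pdx_pdy_eq hU hJ hw

theorem abs_sin_nat_mul_le (n : ℕ) (t : ℝ) : |Real.sin (n * t)| ≤ n * |Real.sin t| := by
  induction n with
  | zero => simp
  | succ n ih =>
    push_cast
    rw [add_mul, one_mul, Real.sin_add]
    refine (abs_add_le _ _).trans ?_
    rw [abs_mul, abs_mul, add_mul, one_mul]
    have h1 := Real.abs_cos_le_one t
    have h2 := Real.abs_cos_le_one (n * t)
    nlinarith [abs_nonneg (Real.sin (n * t)), abs_nonneg (Real.sin t)]

open intervalIntegral in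
/-- Fourier sine coefficients of a holomorphic function on a circle. -/
theorem integral_circleMap_mul_sin {F : ℂ → ℂ} {c : ℂ} {r R : ℝ} (hr : 0 < r) (hrR : r < R)
    (hF : DifferentiableOn ℂ F (Metric.ball c R)) (n : ℕ) :
    ∫ θ in (0 : ℝ)..2 * Real.pi, F (circleMap c r θ) * (Real.sin ((n + 1 : ℕ) * θ) : ℂ) =
      I * (Real.pi * r ^ (n + 1) / (n + 1).factorial : ℝ) * iteratedDeriv (n + 1) F c := by
  have hcl : Metric.closedBall c r ⊆ Metric.ball c R := Metric.closedBall_subset_ball hrR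
  have hD : DiffContOnCl ℂ F (Metric.ball c r) := by
    refine DifferentiableOn.diffContOnCl (hF.mono ?_)
    rwa [closure_ball c hr.ne']
  have hA := hD.circleIntegral_one_div_sub_center_pow_smul hr (n + 1)
  have hB : ∮ z in C(c, r), (z - c) ^ n * F z = 0 := by
    refine DiffContOnCl.circleIntegral_eq_zero hr.le ?_
    refine DifferentiableOn.diffContOnCl ?_
    rw [closure_ball c hr.ne']
    exact ((differentiableOn_id.sub_const c).pow n).mul (hF.mono hcl)
  have hFc : Continuous fun θ : ℝ => F (circleMap c r θ) := by
    refine (hF.continuousOn.mono hcl).comp_continuous (continuous_circleMap c r) fun θ => ?_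
    exact circleMap_mem_closedBall c hr.le θ
  have hrC : (r : ℂ) ≠ 0 := by exact_mod_cast hr.ne'
  have hA' : ∫ θ in (0 : ℝ)..2 * Real.pi, F (circleMap c r θ) * cexp (-((n + 1 : ℕ) * θ * I)) =
      2 * Real.pi * r ^ (n + 1) / (n + 1).factorial * iteratedDeriv (n + 1) F c := by
    have : ∮ z in C(c, r), (1 / (z - c) ^ (n + 1 + 1)) • F z =
        (I / r ^ (n + 1)) *
          ∫ θ in (0 : ℝ)..2 * Real.pi, F (circleMap c r θ) * cexp (-((n + 1 : ℕ) * θ * I)) := by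
      rw [circleIntegral, ← integral_const_mul]
      refine integral_congr fun θ _ => ?_
      simp only [deriv_circleMap, circleMap_sub_center, smul_eq_mul, circleMap_zero]
      rw [Complex.exp_neg, show ((n + 1 : ℕ) * θ * I : ℂ) = (n + 1 : ℕ) * (θ * I) by ring,
        Complex.exp_nat_mul]
      field_simp [Complex.exp_ne_zero]
      ring
    rw [this] at hA
    rw [smul_eq_mul] at hA
    have hI := I_ne_zero
    have hfac : ((n + 1).factorial : ℂ) ≠ 0 := by exact_mod_cast Nat.factorial_ne_zero _
    field_simp at hA ⊢
    linear_combination hA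
  have hB' : ∫ θ in (0 : ℝ)..2 * Real.pi, F (circleMap c r θ) * cexp ((n + 1 : ℕ) * θ * I) =
      0 := by
    have : ∮ z in C(c, r), (z - c) ^ n * F z =
        (I * r ^ (n + 1)) *
          ∫ θ in (0 : ℝ)..2 * Real.pi, F (circleMap c r θ) * cexp ((n + 1 : ℕ) * θ * I) := by
      rw [circleIntegral, ← integral_const_mul]
      refine integral_congr fun θ _ => ?_
      simp only [deriv_circleMap, circleMap_sub_center, smul_eq_mul, circleMap_zero]
      rw [show ((n + 1 : ℕ) * θ * I : ℂ) = (n + 1 : ℕ) * (θ * I) by ring, Complex.exp_nat_mul]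
      ring
    rw [this] at hB
    simpa [hrC] using hB
  have hsub : ∫ θ in (0 : ℝ)..2 * Real.pi,
      F (circleMap c r θ) * (Real.sin ((n + 1 : ℕ) * θ) : ℂ) =
      I / 2 * ((∫ θ in (0 : ℝ)..2 * Real.pi,
        F (circleMap c r θ) * cexp (-((n + 1 : ℕ) * θ * I))) -
        ∫ θ in (0 : ℝ)..2 * Real.pi, F (circleMap c r θ) * cexp ((n + 1 : ℕ) * θ * I)) := by
    have h₁ : Continuous fun θ : ℝ => F (circleMap c r θ) * cexp (-((n + 1 : ℕ) * θ * I)) :=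
      hFc.mul (by fun_prop)
    have h₂ : Continuous fun θ : ℝ => F (circleMap c r θ) * cexp ((n + 1 : ℕ) * θ * I) :=
      hFc.mul (by fun_prop)
    rw [← integral_sub (h₁.intervalIntegrable _ _) (h₂.intervalIntegrable _ _), ← integral_const_mul]
    refine integral_congr fun θ _ => ?_
    simp only [ofReal_sin, Complex.sin]
    push_cast
    rw [neg_mul]
    ring
  rw [hsub, hA', hB']
  push_cast
  ring

/-- Bounds on the Taylor coefficients of a harmonic function that has the sign of `Im (z - c)`. -/
theorem abs_im_iteratedDeriv_le {F : ℂ → ℂ} {c : ℂ} {r R : ℝ} (hr : 0 < r) (hrR : r < R)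
    (hF : DifferentiableOn ℂ F (Metric.ball c R))
    (hsign : ∀ z ∈ Metric.ball c R, 0 ≤ (F z).re * (z - c).im) (n : ℕ) :
    |(iteratedDeriv (n + 1) F c).im| * r ^ n ≤
      (n + 1) * (n + 1).factorial * -(deriv F c).im := by
  have hcl : Metric.closedBall c r ⊆ Metric.ball c R := Metric.closedBall_subset_ball hrR
  have hFc : Continuous fun θ : ℝ => F (circleMap c r θ) := by
    refine (hF.continuousOn.mono hcl).comp_continuous (continuous_circleMap c r) fun θ => ?_
    exact circleMap_mem_closedBall c hr.le θ
  have hcoeff : ∀ m : ℕ, ∫ θ in (0 : ℝ)..2 * Real.pi,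
      (F (circleMap c r θ)).re * Real.sin ((m + 1 : ℕ) * θ) =
      -(Real.pi * r ^ (m + 1) / (m + 1).factorial) * (iteratedDeriv (m + 1) F c).im := by
    intro m
    have h := congrArg re (integral_circleMap_mul_sin hr hrR hF m)
    have h2 := reCLM.intervalIntegral_comp_comm (a := 0) (b := 2 * Real.pi)
      (μ := MeasureTheory.volume)
      (f := fun θ : ℝ => F (circleMap c r θ) * (Real.sin ((m + 1 : ℕ) * θ) : ℂ))
      ((hFc.mul (by fun_prop)).intervalIntegrable _ _)
    simp only [reCLM_apply, re_mul_ofReal] at h2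
    rw [h2, h, mul_assoc, I_mul_re, im_ofReal_mul]
    ring
  have hpos : ∀ θ : ℝ, 0 ≤ (F (circleMap c r θ)).re * Real.sin θ := by
    intro θ
    have := hsign _ (hcl (circleMap_mem_closedBall c hr.le θ))
    rw [circleMap_sub_center, circleMap_zero, im_ofReal_mul, exp_ofReal_mul_I_im] at this
    have h' : 0 ≤ r * ((F (circleMap c r θ)).re * Real.sin θ) := by linarith
    exact nonneg_of_mul_nonneg_right h' hr
  have hle : |∫ θ in (0 : ℝ)..2 * Real.pi,
      (F (circleMap c r θ)).re * Real.sin ((n + 1 : ℕ) * θ)| ≤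
      (n + 1) * ∫ θ in (0 : ℝ)..2 * Real.pi, (F (circleMap c r θ)).re * Real.sin θ := by
    rw [← intervalIntegral.integral_const_mul]
    rw [← Real.norm_eq_abs]
    refine intervalIntegral.norm_integral_le_of_norm_le (by positivity) ?_
      ((continuous_const.mul ((continuous_re.comp hFc).mul Real.continuous_sin)).intervalIntegrable
        _ _)
    refine Filter.Eventually.of_forall fun θ _ => ?_
    rw [← abs_of_nonneg (hpos θ), abs_mul, Real.norm_eq_abs, abs_mul, mul_left_comm]
    have h := abs_sin_nat_mul_le (n + 1) θ
    push_cast at h ⊢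
    exact mul_le_mul_of_nonneg_left h (abs_nonneg _)
  have h0 := hcoeff 0
  simp only [zero_add, Nat.cast_one, one_mul, pow_one, Nat.factorial_one, div_one,
    iteratedDeriv_one] at h0
  rw [hcoeff n, h0, abs_mul, abs_neg, abs_of_pos (by positivity)] at hle
  have hfac : (0 : ℝ) < (n + 1).factorial := by exact_mod_cast Nat.factorial_pos _
  have hpr : 0 < Real.pi * r := by positivity
  refine le_of_mul_le_mul_left ?_ hpr
  rw [div_mul_eq_mul_div, div_le_iff₀ hfac] at hle
  calc _ = _ := by ring
    _ ≤ _ := hle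
    _ = _ := by ring

theorem ball_ofReal_subset_strip (x h : ℝ) :
    Metric.ball (x : ℂ) h ⊆ {z : ℂ | |z.im| < h} := by
  intro z hz
  rw [Metric.mem_ball, dist_eq_norm] at hz
  simpa using (abs_im_le_norm (z - x)).trans_lt hz

/-- Local derivative bounds at real points, from positivity in the upper half strip alone. -/
theorem abs_re_iteratedDeriv_vertGrad_le {h : ℝ} (hh : 0 < h) {J : ℂ → ℝ}
    (hJ : IsHarmonicOn J {z : ℂ | |z.im| < h})
    (hodd : ∀ z : ℂ, |z.im| < h → J ((starRingEnd ℂ) z) = -J z)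
    (hpos : ∀ z : ℂ, 0 < z.im → z.im < h → 0 < J z) (x : ℝ) (n : ℕ) :
    |(iteratedDeriv n (vertGrad J) x).re| * h ^ n ≤ (n + 1) * (n + 1).factorial * pdy J x := by
  have hsub := ball_ofReal_subset_strip x h
  obtain ⟨F, hF, hJF⟩ :=
    InnerProductSpace.HarmonicOnNhd.exists_analyticOnNhd_ball_re_eq
      (fun w hw => hJ.harmonicOnNhd (isOpen_strip h) w (hsub hw))
  have hx : (x : ℂ) ∈ Metric.ball (x : ℂ) h := Metric.mem_ball_self hh
  have hgF : ∀ w ∈ Metric.ball (x : ℂ) h, vertGrad J w = I * deriv F w := fun w hw =>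
    vertGrad_eq_I_mul_deriv Metric.isOpen_ball hF.differentiableOn hJF hw
  have hsign : ∀ z ∈ Metric.ball (x : ℂ) h, 0 ≤ (F z).re * (z - x).im := by
    intro z hz
    have hJz : (F z).re = J z := hJF hz
    have hzs : |z.im| < h := hsub hz
    rw [hJz, sub_im, ofReal_im, sub_zero]
    rw [abs_lt] at hzs
    rcases lt_trichotomy z.im 0 with hlt | heq | hgt
    · have h1 := hpos ((starRingEnd ℂ) z) (by simpa using hlt) (by rw [conj_im]; linarith)
      rw [hodd z (hsub hz)] at h1
      nlinarith
    · simp [heq]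
    · exact (mul_pos (hpos z hgt hzs.2) hgt).le
  have hiter : iteratedDeriv n (vertGrad J) x = I * iteratedDeriv (n + 1) F x := by
    have hev : vertGrad J =ᶠ[𝓝 (x : ℂ)] fun w => I * deriv F w := by
      filter_upwards [Metric.ball_mem_nhds (x : ℂ) hh] with w hw using hgF w hw
    rw [hev.iteratedDeriv_eq, iteratedDeriv_succ',
      iteratedDeriv_const_mul_field]
  have hy : pdy J x = -(deriv F x).im := by
    rw [← re_vertGrad, hgF _ hx, I_mul_re]
  rw [hiter, I_mul_re, abs_neg, hy]
  have hlim : Tendsto (fun r : ℝ => |(iteratedDeriv (n + 1) F x).im| * r ^ n) (𝓝[<] h)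
      (𝓝 (|(iteratedDeriv (n + 1) F x).im| * h ^ n)) :=
    (Continuous.tendsto (by fun_prop) h).mono_left nhdsWithin_le_nhds
  refine le_of_tendsto hlim ?_
  filter_upwards [Ioo_mem_nhdsLT hh] with r hr using
    abs_im_iteratedDeriv_le hr.1 hr.2 hF.differentiableOn hsign n

/-- The unnormalised `n`-th Fourier coefficient of a function over `[0, 2π]`. -/
def periodCoeff (f : ℝ → ℂ) (n : ℤ) : ℂ :=
  ∫ x in (0 : ℝ)..2 * Real.pi, f x * cexp (-(n * x * I))

theorem exp_neg_int_mul_two_pi (n : ℤ) : cexp (-(n * (2 * Real.pi : ℝ) * I)) = 1 := by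
  rw [Complex.exp_eq_one_iff]
  exact ⟨-n, by push_cast; ring⟩

theorem periodCoeff_deriv {f f' : ℝ → ℂ} (hf : ∀ x, HasDerivAt f (f' x) x)
    (hf' : Continuous f') (hper : f (2 * Real.pi) = f 0) (n : ℤ) :
    periodCoeff f' n = n * I * periodCoeff f n := by
  have hfc : Continuous f := continuous_iff_continuousAt.2 fun x => (hf x).continuousAt
  have he : ∀ x : ℝ, HasDerivAt (fun x : ℝ => cexp (-(n * x * I)))
      (cexp (-(n * x * I)) * -(n * I)) x := by
    intro x
    have h1 : HasDerivAt (fun x : ℝ => (-(n * x * I) : ℂ)) (-(n * I)) x := by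
      simpa using (((hasDerivAt_id x).ofReal_comp.const_mul (n : ℂ)).mul_const I).fun_neg
    exact h1.cexp
  have hd : ∀ x ∈ uIcc 0 (2 * Real.pi), HasDerivAt (fun x : ℝ => f x * cexp (-(n * x * I)))
      (f' x * cexp (-(n * x * I)) + f x * (cexp (-(n * x * I)) * -(n * I))) x :=
    fun x _ => (hf x).mul (he x)
  have hi := intervalIntegral.integral_eq_sub_of_hasDerivAt hd
    (Continuous.intervalIntegrable (by fun_prop) _ _)
  rw [intervalIntegral.integral_add (Continuous.intervalIntegrable (by fun_prop) _ _)
    (Continuous.intervalIntegrable (by fun_prop) _ _)] at hi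
  simp only [exp_neg_int_mul_two_pi, hper] at hi
  simp only [ofReal_zero, mul_zero, zero_mul, neg_zero, Complex.exp_zero, sub_self] at hi
  have h2 : ∫ x in (0 : ℝ)..2 * Real.pi, f x * (cexp (-(n * x * I)) * -(n * I)) =
      -(n * I) * periodCoeff f n := by
    rw [periodCoeff, ← intervalIntegral.integral_const_mul]
    exact intervalIntegral.integral_congr fun x _ => by ring
  rw [h2] at hi
  rw [periodCoeff]
  linear_combination hi

/-- A periodic function with summable Fourier coefficients is close to its mean. -/
theorem norm_sub_periodCoeff_zero_le {f : ℝ → ℂ} (hf : Continuous f)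
    (hper : Function.Periodic f (2 * Real.pi)) {b : ℤ → ℝ} (hb : Summable b)
    (hb0 : ∀ n, 0 ≤ b n) (hfb : ∀ n, n ≠ 0 → ‖periodCoeff f n‖ ≤ b n) (x : ℝ) :
    ‖2 * Real.pi * f x - periodCoeff f 0‖ ≤ ∑' n, b n := by
  have hT : Fact (0 < 2 * Real.pi) := ⟨Real.two_pi_pos⟩
  have hpi : (2 * Real.pi : ℂ) ≠ 0 := by exact_mod_cast Real.two_pi_pos.ne'
  let φ : C(AddCircle (2 * Real.pi), ℂ) :=
    ⟨hper.lift, continuous_coinduced_dom.2 hf⟩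
  have hφ : ∀ y : ℝ, φ (y : AddCircle (2 * Real.pi)) = f y := fun y => hper.lift_coe y
  have hco : ∀ n, fourierCoeff φ n = (1 / (2 * Real.pi)) * periodCoeff f n := by
    intro n
    rw [fourierCoeff_eq_intervalIntegral φ n 0, zero_add, real_smul, periodCoeff]
    push_cast
    congr 1
    refine intervalIntegral.integral_congr fun y _ => ?_
    simp only [hφ, fourier_coe_apply, smul_eq_mul]
    rw [mul_comm]
    congr 2
    push_cast
    field_simp
  have hsum : Summable (fourierCoeff φ) := by
    refine Summable.of_norm_bounded_eventually hb ?_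
    filter_upwards [(Set.finite_singleton (0 : ℤ)).compl_mem_cofinite] with n hn
    rw [hco, norm_mul]
    refine (mul_le_of_le_one_left (norm_nonneg _) ?_).trans (hfb n hn)
    rw [norm_div, norm_one, norm_mul, norm_real, Real.norm_eq_abs, abs_of_pos Real.pi_pos,
      RCLike.norm_ofNat]
    exact div_le_one_of_le₀ (by linarith [Real.pi_gt_three]) (by positivity)
  have hs := (has_pointwise_sum_fourier_series_of_summable hsum (x : AddCircle (2 * Real.pi)))
  have hs' := (hs.mul_left (2 * Real.pi : ℂ)).sub (hasSum_ite_eq (0 : ℤ) (periodCoeff f 0))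
  rw [hφ] at hs'
  refine hs'.norm_le_of_bounded hb.hasSum fun n => ?_
  have hterm : 2 * Real.pi * (fourierCoeff φ n • fourier n (x : AddCircle (2 * Real.pi))) =
      periodCoeff f n * fourier n (x : AddCircle (2 * Real.pi)) := by
    rw [hco, smul_eq_mul]
    field_simp
  rw [hterm]
  by_cases hn : n = 0
  · subst hn
    simpa using hb0 0
  · rw [if_neg hn, sub_zero, norm_mul]
    have : ‖fourier n (x : AddCircle (2 * Real.pi))‖ = 1 := Circle.norm_coe _
    rw [this, mul_one]
    exact hfb n hn

theorem vertGrad_conj {h : ℝ} {J : ℂ → ℝ}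
    (hodd : ∀ z : ℂ, |z.im| < h → J ((starRingEnd ℂ) z) = -J z) {z : ℂ} (hz : |z.im| < h) :
    vertGrad J ((starRingEnd ℂ) z) = (starRingEnd ℂ) (vertGrad J z) := by
  have hx : pdx J ((starRingEnd ℂ) z) = -pdx J z := by
    rw [pdx, pdx, ← deriv.fun_neg]
    congr 1
    funext x
    rw [← hodd (z + x) (by simpa using hz), map_add, conj_ofReal]
  have hy : pdy J ((starRingEnd ℂ) z) = pdy J z := by
    have hev : (fun y : ℝ => J ((starRingEnd ℂ) z + y * I)) =ᶠ[𝓝 0]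
        fun y : ℝ => -(fun t : ℝ => J (z + t * I)) (-y) := by
      have hc : Tendsto (fun y : ℝ => z + ((-y : ℝ) : ℂ) * I) (𝓝 0) (𝓝 z) := by
        refine Continuous.tendsto' (by fun_prop) _ _ (by simp)
      filter_upwards [hc.eventually ((isOpen_strip h).mem_nhds hz)] with y hy
      rw [← hodd _ hy]
      simp
    have hneg := deriv_comp_neg (fun t : ℝ => J (z + t * I)) 0
    rw [pdy, hev.deriv_eq, deriv.fun_neg, hneg, neg_neg, neg_zero, pdy]
  rw [vertGrad, vertGrad, hx, hy]
  simp

theorem vertGrad_add_two_pi {h : ℝ} {J : ℂ → ℝ}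
    (hper : ∀ z : ℂ, |z.im| < h → J (z + 2 * Real.pi) = J z) {z : ℂ} (hz : |z.im| < h) :
    vertGrad J (z + 2 * Real.pi) = vertGrad J z := by
  have hx : pdx J (z + 2 * Real.pi) = pdx J z := by
    rw [pdx, pdx]
    congr 1
    funext x
    rw [← hper (z + x) (by simpa using hz), add_right_comm]
  have hy : pdy J (z + 2 * Real.pi) = pdy J z := by
    refine EventuallyEq.deriv_eq ?_
    have hc : Tendsto (fun y : ℝ => z + (y : ℂ) * I) (𝓝 0) (𝓝 z) :=
      Continuous.tendsto' (by fun_prop) _ _ (by simp)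
    filter_upwards [hc.eventually ((isOpen_strip h).mem_nhds hz)] with y hy
    rw [← hper _ hy, add_right_comm]
  rw [vertGrad, vertGrad, hx, hy]

/-- Fourier coefficients of a periodic holomorphic function on horizontal lines. -/
theorem periodCoeff_add_mul_I {g : ℂ → ℂ} {h : ℝ}
    (hg : DifferentiableOn ℂ g {z : ℂ | |z.im| < h})
    (hper : ∀ z : ℂ, |z.im| < h → g (z + 2 * Real.pi) = g z) {y : ℝ} (hy : |y| < h) (n : ℤ) :
    periodCoeff (fun x : ℝ => g (x + y * I)) n =
      Real.exp (-(n * y)) * periodCoeff (fun x : ℝ => g x) n := by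
  have hsub : uIcc (0 : ℂ).re (2 * Real.pi + y * I : ℂ).re ×ℂ
      uIcc (0 : ℂ).im (2 * Real.pi + y * I : ℂ).im ⊆ {z : ℂ | |z.im| < h} := by
    intro z hz
    have h1 : z.im ∈ uIcc 0 y := by simpa using hz.2
    have h2 := Set.abs_sub_left_of_mem_uIcc h1
    simp only [sub_zero] at h2
    exact h2.trans_lt hy
  have hd : DifferentiableOn ℂ (fun z => g z * cexp (-(n * z * I))) {z : ℂ | |z.im| < h} :=
    hg.mul (by fun_prop)
  have key := integral_boundary_rect_eq_zero_of_differentiableOn _ 0 (2 * Real.pi + y * I)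
    (hd.mono hsub)
  have hre : (2 * Real.pi + y * I : ℂ).re = 2 * Real.pi := by simp
  have him : (2 * Real.pi + y * I : ℂ).im = y := by simp
  rw [hre, him, zero_re, zero_im] at key
  have hside : ∫ t in (0 : ℝ)..y, g ((2 * Real.pi : ℝ) + t * I) *
      cexp (-(n * ((2 * Real.pi : ℝ) + t * I) * I)) =
      ∫ t in (0 : ℝ)..y, g ((0 : ℝ) + t * I) * cexp (-(n * ((0 : ℝ) + t * I) * I)) := by
    refine intervalIntegral.integral_congr fun t ht => ?_
    have ht' : |t| < h := by
      have h2 := Set.abs_sub_left_of_mem_uIcc ht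
      simp only [sub_zero] at h2
      exact h2.trans_lt hy
    have hp := hper (t * I) (by simpa using ht')
    have he : cexp (-(n * ((2 * Real.pi : ℝ) + t * I) * I)) = cexp (-(n * (t * I) * I)) := by
      rw [show (-(n * ((2 * Real.pi : ℝ) + t * I) * I) : ℂ) =
        -(n * (2 * Real.pi : ℝ) * I) + -(n * (t * I) * I) by ring, Complex.exp_add,
        exp_neg_int_mul_two_pi, one_mul]
    simp only [he, ofReal_zero, zero_add]
    rw [← hp]
    push_cast
    rw [add_comm]
  rw [hside] at key
  have htop : ∫ x in (0 : ℝ)..2 * Real.pi, g (x + y * I) * cexp (-(n * (x + y * I) * I)) =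
      Real.exp (n * y) * periodCoeff (fun x : ℝ => g (x + y * I)) n := by
    rw [periodCoeff, ← intervalIntegral.integral_const_mul]
    refine intervalIntegral.integral_congr fun x _ => ?_
    rw [show (-(n * (x + y * I) * I) : ℂ) = (n * y : ℝ) + -(n * x * I) by
      push_cast; linear_combination (-(n * y) : ℂ) * I_sq, Complex.exp_add, ofReal_exp]
    ring
  rw [htop] at key
  simp only [ofReal_zero, zero_mul, add_zero] at key
  change periodCoeff (fun x : ℝ => g x) n - _ + _ - _ = 0 at key
  have hexp : (Real.exp (-(n * y)) : ℂ) * Real.exp (n * y) = 1 := by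
    rw [← ofReal_mul, ← Real.exp_add]
    simp
  linear_combination (-(Real.exp (-(n * y)) : ℂ)) * key -
    periodCoeff (fun x : ℝ => g (x + y * I)) n * hexp

theorem periodCoeff_pdy {h : ℝ} {J : ℂ → ℝ} (hJ : IsHarmonicOn J {z : ℂ | |z.im| < h})
    (hodd : ∀ z : ℂ, |z.im| < h → J ((starRingEnd ℂ) z) = -J z)
    (hper : ∀ z : ℂ, |z.im| < h → J (z + 2 * Real.pi) = J z) {y : ℝ} (hy : |y| < h) (n : ℤ) :
    periodCoeff (fun x : ℝ => (pdy J (x + y * I) : ℂ)) n =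
      Real.cosh (n * y) * periodCoeff (fun x : ℝ => vertGrad J x) n := by
  have hg := differentiableOn_vertGrad (isOpen_strip h) hJ
  have hline : ∀ t : ℝ, |t| < h → Continuous fun x : ℝ => vertGrad J (x + t * I) := fun t ht =>
    hg.continuousOn.comp_continuous (by fun_prop) fun x => by simpa using ht
  have hperg := fun z hz => vertGrad_add_two_pi hper (z := z) hz
  have hy' : |-y| < h := by rwa [abs_neg]
  have h1 := periodCoeff_add_mul_I hg hperg hy n
  have h2 := periodCoeff_add_mul_I hg hperg hy' n
  have hsum : periodCoeff (fun x : ℝ => (pdy J (x + y * I) : ℂ)) n =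
      1 / 2 * (periodCoeff (fun x : ℝ => vertGrad J (x + y * I)) n +
        periodCoeff (fun x : ℝ => vertGrad J (x + (-y : ℝ) * I)) n) := by
    have c1 : Continuous fun x : ℝ => vertGrad J (x + y * I) * cexp (-(n * x * I)) :=
      (hline y hy).mul (by fun_prop)
    have c2 : Continuous fun x : ℝ => vertGrad J (x + (-y : ℝ) * I) * cexp (-(n * x * I)) :=
      (hline (-y) hy').mul (by fun_prop)
    simp only [periodCoeff]
    rw [← intervalIntegral.integral_add (c1.intervalIntegrable _ _) (c2.intervalIntegrable _ _),
      ← intervalIntegral.integral_const_mul]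
    refine intervalIntegral.integral_congr fun x _ => ?_
    have hc := vertGrad_conj hodd (z := x + y * I) (by simpa using hy)
    have hxy : (starRingEnd ℂ) (x + y * I : ℂ) = x + (-y : ℝ) * I := by simp
    rw [hxy] at hc
    simp only [hc, ← re_vertGrad J, re_eq_add_conj]
    ring
  rw [hsum, h1, h2, Real.cosh_eq]
  push_cast
  rw [mul_neg, neg_neg]
  ring

theorem hasDerivAt_vertical {h : ℝ} {J : ℂ → ℝ} (hJ : IsHarmonicOn J {z : ℂ | |z.im| < h})
    (x : ℝ) {y : ℝ} (hy : |y| < h) :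
    HasDerivAt (fun t : ℝ => J (x + t * I)) (pdy J (x + y * I)) y := by
  have hd : DifferentiableAt ℝ J (x + y * I) :=
    (hJ.1.contDiffAt ((isOpen_strip h).mem_nhds (by simpa using hy))).differentiableAt
      (by norm_num)
  rw [pdy_eq_fderiv hd]
  exact hd.hasFDerivAt.comp_hasDerivAt y (hasDerivAt_add_ofReal_mul_I x y)

theorem periodCoeff_eq_integral_cosh {h : ℝ} {J : ℂ → ℝ}
    (hJ : IsHarmonicOn J {z : ℂ | |z.im| < h})
    (hodd : ∀ z : ℂ, |z.im| < h → J ((starRingEnd ℂ) z) = -J z)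
    (hper : ∀ z : ℂ, |z.im| < h → J (z + 2 * Real.pi) = J z) {y : ℝ} (hy : |y| < h) (n : ℤ) :
    periodCoeff (fun x : ℝ => (J (x + y * I) : ℂ)) n =
      (∫ t in (0 : ℝ)..y, Real.cosh (n * t) : ℝ) * periodCoeff (fun x : ℝ => vertGrad J x) n := by
  have hg := differentiableOn_vertGrad (isOpen_strip h) hJ
  have habs : ∀ t ∈ uIcc 0 y, |t| < h := fun t ht => by
    have h2 := Set.abs_sub_left_of_mem_uIcc ht
    simp only [sub_zero] at h2
    exact h2.trans_lt hy
  have hcont : ContinuousOn (fun p : ℝ × ℝ => (pdy J (p.1 + p.2 * I) : ℂ))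
      (univ ×ˢ uIcc 0 y) := by
    simp only [← re_vertGrad J]
    refine (continuous_ofReal.comp continuous_re).comp_continuousOn
      (hg.continuousOn.comp (by fun_prop) fun p hp => ?_)
    simpa using habs p.2 hp.2
  have hprim : ∀ x : ℝ, (J (x + y * I) : ℂ) = ∫ t in (0 : ℝ)..y, (pdy J (x + t * I) : ℂ) := by
    intro x
    have h0 : J x = 0 := by
      have := hodd x (by simpa using (abs_nonneg y).trans_lt hy)
      rw [conj_ofReal] at this
      linarith
    have hci : ContinuousOn (fun t : ℝ => (pdy J (x + t * I) : ℂ)) (uIcc 0 y) :=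
      hcont.comp (f := fun t : ℝ => (x, t)) (by fun_prop) fun t ht => ⟨mem_univ _, ht⟩
    rw [intervalIntegral.integral_eq_sub_of_hasDerivAt
      (f := fun t : ℝ => (J (x + t * I) : ℂ))
      (fun t ht => (hasDerivAt_vertical hJ x (habs t ht)).ofReal_comp) hci.intervalIntegrable]
    simp [h0]
  have hswap : periodCoeff (fun x : ℝ => (J (x + y * I) : ℂ)) n =
      ∫ t in (0 : ℝ)..y, periodCoeff (fun x : ℝ => (pdy J (x + t * I) : ℂ)) n := by
    simp only [periodCoeff, hprim, ← intervalIntegral.integral_mul_const]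
    refine MeasureTheory.intervalIntegral_intervalIntegral_swap ?_
    have hK : IsCompact (uIcc 0 (2 * Real.pi) ×ˢ uIcc 0 y) := isCompact_uIcc.prod isCompact_uIcc
    refine MeasureTheory.IntegrableOn.mono_set (ContinuousOn.integrableOn_compact hK ?_)
      (prod_mono uIoc_subset_uIcc uIoc_subset_uIcc)
    exact (hcont.mono (prod_mono_left (subset_univ _))).mul (by fun_prop)
  rw [hswap, ← intervalIntegral.integral_ofReal, ← intervalIntegral.integral_mul_const]
  refine intervalIntegral.integral_congr fun t ht => ?_
  exact periodCoeff_pdy hJ hodd hper (habs t ht) n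

theorem exp_le_integral_cosh {m y : ℝ} (hm : 1 ≤ m) (hy : 1 ≤ y) :
    Real.exp (m * y) / (4 * m) ≤ ∫ t in (0 : ℝ)..y, Real.cosh (m * t) := by
  have hm0 : 0 < m := by linarith
  have hd : ∀ t ∈ uIcc 0 y, HasDerivAt (fun t : ℝ => Real.sinh (m * t) / m)
      (Real.cosh (m * t)) t := by
    intro t _
    have h1 : HasDerivAt (fun t : ℝ => m * t) m t := by simpa using (hasDerivAt_id t).const_mul m
    have h2 := h1.sinh.div_const m
    rwa [mul_div_cancel_right₀ _ hm0.ne'] at h2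
  rw [intervalIntegral.integral_eq_sub_of_hasDerivAt hd
    (Continuous.intervalIntegrable (by fun_prop) _ _)]
  simp only [mul_zero, Real.sinh_zero, zero_div, sub_zero]
  rw [← div_div, div_le_div_iff_of_pos_right hm0, Real.sinh_eq]
  have hmy : 1 ≤ m * y := by nlinarith
  have h1 : 2 ≤ Real.exp (m * y) := by linarith [Real.add_one_le_exp (m * y)]
  have h2 : Real.exp (-(m * y)) ≤ 1 := Real.exp_le_one_iff.2 (by linarith)
  linarith

/-- Decay of the Fourier coefficients on the real line, relative to the mean. -/
theorem norm_periodCoeff_vertGrad_le {h : ℝ} (hh : 1 < h) {J : ℂ → ℝ}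
    (hJ : IsHarmonicOn J {z : ℂ | |z.im| < h})
    (hodd : ∀ z : ℂ, |z.im| < h → J ((starRingEnd ℂ) z) = -J z)
    (hpos : ∀ z : ℂ, 0 < z.im → z.im < h → 0 < J z)
    (hper : ∀ z : ℂ, |z.im| < h → J (z + 2 * Real.pi) = J z) {n : ℤ} (hn : n ≠ 0) :
    ‖periodCoeff (fun x : ℝ => vertGrad J x) n‖ ≤ 4 * |(n : ℝ)| * h * Real.exp (-(|(n : ℝ)| * h)) *
      (periodCoeff (fun x : ℝ => vertGrad J x) 0).re := by
  set C := ‖periodCoeff (fun x : ℝ => vertGrad J x) n‖ with hC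
  set A := (periodCoeff (fun x : ℝ => vertGrad J x) 0).re with hA
  have hn1 : 1 ≤ |(n : ℝ)| := by exact_mod_cast Int.one_le_abs hn
  have hbound : ∀ y ∈ Ioo 1 h, C ≤ 4 * |(n : ℝ)| * y * Real.exp (-(|(n : ℝ)| * y)) * A := by
    intro y hy
    have hy0 : 0 < y := by linarith [hy.1]
    have hyh : |y| < h := by rw [abs_of_pos hy0]; exact hy.2
    have hJc : Continuous fun x : ℝ => J (x + y * I) :=
      hJ.1.continuousOn.comp_continuous (by fun_prop) fun x => by simpa using hyh
    have hJpos : ∀ x : ℝ, 0 < J (x + y * I) := fun x =>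
      hpos _ (by simpa using hy0) (by simpa using hy.2)
    have hzero : ∫ x in (0 : ℝ)..2 * Real.pi, J (x + y * I) = y * A := by
      have h0 := congrArg re (periodCoeff_eq_integral_cosh hJ hodd hper hyh 0)
      rw [re_ofReal_mul] at h0
      simp only [periodCoeff, Int.cast_zero, zero_mul, neg_zero, Complex.exp_zero, mul_one,
        Real.cosh_zero, intervalIntegral.integral_const, sub_zero, smul_eq_mul,
        intervalIntegral.integral_ofReal, ofReal_re] at h0
      rw [h0, hA]
      simp [periodCoeff]
    have hle : ‖periodCoeff (fun x : ℝ => (J (x + y * I) : ℂ)) n‖ ≤ y * A := by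
      rw [← hzero]
      refine intervalIntegral.norm_integral_le_of_norm_le (by positivity) ?_
        (hJc.intervalIntegrable _ _)
      refine Filter.Eventually.of_forall fun x _ => ?_
      rw [norm_mul, norm_real, Real.norm_eq_abs, abs_of_pos (hJpos x),
        show (-(n * x * I) : ℂ) = ((-(n * x) : ℝ) : ℂ) * I by push_cast; ring,
        norm_exp_ofReal_mul_I, mul_one]
    have hcosh : ∫ t in (0 : ℝ)..y, Real.cosh (n * t) =
        ∫ t in (0 : ℝ)..y, Real.cosh (|(n : ℝ)| * t) := by
      refine intervalIntegral.integral_congr fun t _ => ?_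
      rw [← Real.cosh_abs (n * t), ← Real.cosh_abs (|(n : ℝ)| * t), abs_mul, abs_mul, abs_abs]
    have hlow := exp_le_integral_cosh hn1 hy.1.le
    have hI0 : 0 ≤ ∫ t in (0 : ℝ)..y, Real.cosh (|(n : ℝ)| * t) := le_trans (by positivity) hlow
    rw [periodCoeff_eq_integral_cosh hJ hodd hper hyh n, norm_mul, norm_real, Real.norm_eq_abs,
      hcosh, abs_of_nonneg hI0] at hle
    have h3 := (mul_le_mul_of_nonneg_right hlow (norm_nonneg _)).trans hle
    rw [← hC, div_mul_eq_mul_div, div_le_iff₀ (by positivity)] at h3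
    rw [Real.exp_neg]
    have he := Real.exp_pos (|(n : ℝ)| * y)
    rw [← div_eq_mul_inv, div_mul_eq_mul_div, le_div_iff₀ he]
    linarith
  have hlim : Tendsto (fun y : ℝ => 4 * |(n : ℝ)| * y * Real.exp (-(|(n : ℝ)| * y)) * A) (𝓝[<] h)
      (𝓝 (4 * |(n : ℝ)| * h * Real.exp (-(|(n : ℝ)| * h)) * A)) :=
    (Continuous.tendsto (by fun_prop) h).mono_left nhdsWithin_le_nhds
  refine ge_of_tendsto hlim ?_
  filter_upwards [Ioo_mem_nhdsLT hh] with y hy using hbound y hy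

theorem deriv_add_two_pi {g : ℂ → ℂ} {h : ℝ}
    (hper : ∀ z : ℂ, |z.im| < h → g (z + 2 * Real.pi) = g z) {z : ℂ} (hz : |z.im| < h) :
    deriv g (z + 2 * Real.pi) = deriv g z := by
  rw [← deriv_comp_add_const]
  refine EventuallyEq.deriv_eq ?_
  filter_upwards [(isOpen_strip h).mem_nhds hz] with w hw using hper w hw

theorem continuous_restrict_real {g : ℂ → ℂ} {h : ℝ} (hh : 0 < h)
    (hg : DifferentiableOn ℂ g {z : ℂ | |z.im| < h}) : Continuous fun x : ℝ => g x :=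
  hg.continuousOn.comp_continuous continuous_ofReal fun x => by simpa using hh

theorem periodic_restrict_real {g : ℂ → ℂ} {h : ℝ} (hh : 0 < h)
    (hper : ∀ z : ℂ, |z.im| < h → g (z + 2 * Real.pi) = g z) :
    Function.Periodic (fun x : ℝ => g x) (2 * Real.pi) := fun x => by
  simpa using hper x (by simpa using hh)

theorem periodCoeff_complex_deriv {g : ℂ → ℂ} {h : ℝ} (hh : 0 < h)
    (hg : DifferentiableOn ℂ g {z : ℂ | |z.im| < h})
    (hper : ∀ z : ℂ, |z.im| < h → g (z + 2 * Real.pi) = g z) (n : ℤ) :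
    periodCoeff (fun x : ℝ => deriv g x) n = n * I * periodCoeff (fun x : ℝ => g x) n := by
  refine periodCoeff_deriv (fun x => ?_)
    (continuous_restrict_real hh (hg.deriv (isOpen_strip h))) ?_ n
  · exact (hg.differentiableAt
      ((isOpen_strip h).mem_nhds (by simpa using hh))).hasDerivAt.comp_ofReal
  · simpa using periodic_restrict_real hh hper 0

/-- The majorant for the Fourier coefficients of the first derivatives of `vertGrad J`. -/
def coeffMajorant (n : ℤ) : ℝ := 4 * |(n : ℝ)| ^ 3 * Real.exp (1 - |(n : ℝ)|)

theorem coeffMajorant_nonneg (n : ℤ) : 0 ≤ coeffMajorant n := by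
  unfold coeffMajorant
  positivity

theorem summable_coeffMajorant : Summable coeffMajorant := by
  have h : Summable fun n : ℕ => 4 * (n : ℝ) ^ 3 * Real.exp (1 - n) := by
    refine ((Real.summable_pow_mul_exp_neg_nat_mul 3 one_pos).mul_left
      (4 * Real.exp 1)).congr fun n => ?_
    rw [sub_eq_add_neg, Real.exp_add, neg_one_mul]
    ring
  refine Summable.of_nat_of_neg ?_ ?_ <;> simpa [coeffMajorant] using h

/-- On a thick strip, the derivatives of `vertGrad J` are close to their means on the real line. -/
theorem norm_sub_mean_le {h : ℝ} (hh : 1 < h) {J : ℂ → ℝ}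
    (hJ : IsHarmonicOn J {z : ℂ | |z.im| < h})
    (hodd : ∀ z : ℂ, |z.im| < h → J ((starRingEnd ℂ) z) = -J z)
    (hpos : ∀ z : ℂ, 0 < z.im → z.im < h → 0 < J z)
    (hper : ∀ z : ℂ, |z.im| < h → J (z + 2 * Real.pi) = J z) {f : ℝ → ℂ} (hf : Continuous f)
    (hfper : Function.Periodic f (2 * Real.pi))
    (hcoeff : ∀ n : ℤ, n ≠ 0 → ‖periodCoeff f n‖ ≤
      |(n : ℝ)| ^ 2 * ‖periodCoeff (fun x : ℝ => vertGrad J x) n‖) (x : ℝ) :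
    ‖2 * Real.pi * f x - periodCoeff f 0‖ ≤
      (∑' n, coeffMajorant n) * (h * Real.exp (-h)) *
        (periodCoeff (fun x : ℝ => vertGrad J x) 0).re := by
  set A := (periodCoeff (fun x : ℝ => vertGrad J x) 0).re with hA
  have hdecay := fun n (hn : n ≠ 0) => norm_periodCoeff_vertGrad_le hh hJ hodd hpos hper (n := n) hn
  rw [← hA] at hdecay
  have hh0 : 0 < h := by linarith
  have hA0 : 0 ≤ A := by
    have h1 := (norm_nonneg _).trans (hdecay 1 one_ne_zero)
    exact nonneg_of_mul_nonneg_right h1 (by simp only [Int.cast_one, abs_one]; positivity)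
  have hb : ∀ n : ℤ, n ≠ 0 → ‖periodCoeff f n‖ ≤ h * Real.exp (-h) * A * coeffMajorant n := by
    intro n hn
    have hn1 : 1 ≤ |(n : ℝ)| := by exact_mod_cast Int.one_le_abs hn
    have hexp : Real.exp (-(|(n : ℝ)| * h)) ≤ Real.exp (-h) * Real.exp (1 - |(n : ℝ)|) := by
      rw [← Real.exp_add, Real.exp_le_exp]
      nlinarith
    calc ‖periodCoeff f n‖ ≤ |(n : ℝ)| ^ 2 * (4 * |(n : ℝ)| * h * Real.exp (-(|(n : ℝ)| * h)) * A) :=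
          (hcoeff n hn).trans (mul_le_mul_of_nonneg_left (hdecay n hn) (by positivity))
      _ ≤ |(n : ℝ)| ^ 2 *
          (4 * |(n : ℝ)| * h * (Real.exp (-h) * Real.exp (1 - |(n : ℝ)|)) * A) := by gcongr
      _ = h * Real.exp (-h) * A * coeffMajorant n := by
        rw [coeffMajorant]
        ring
  have := norm_sub_periodCoeff_zero_le hf hfper (summable_coeffMajorant.mul_left _)
    (fun n => mul_nonneg (by positivity) (coeffMajorant_nonneg n)) hb x
  rw [tsum_mul_left] at this
  linarith

/-- Derivative bounds on thick strips. -/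
theorem abs_derivatives_le_of_thick {h : ℝ} (hh : 1 < h) {J : ℂ → ℝ}
    (hsmall : (∑' n, coeffMajorant n) * (h * Real.exp (-h)) ≤ 1 / 2)
    (hJ : IsHarmonicOn J {z : ℂ | |z.im| < h})
    (hodd : ∀ z : ℂ, |z.im| < h → J ((starRingEnd ℂ) z) = -J z)
    (hpos : ∀ z : ℂ, 0 < z.im → z.im < h → 0 < J z)
    (hper : ∀ z : ℂ, |z.im| < h → J (z + 2 * Real.pi) = J z) (x : ℝ) :
    |(deriv (vertGrad J) x).re| ≤
        2 * ((∑' n, coeffMajorant n) * (h * Real.exp (-h))) * pdy J x ∧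
      |(deriv (deriv (vertGrad J)) x).re| ≤
        2 * ((∑' n, coeffMajorant n) * (h * Real.exp (-h))) * pdy J x := by
  have hh0 : 0 < h := by linarith
  have hU := isOpen_strip h
  have hg := differentiableOn_vertGrad hU hJ
  have hgp := fun z hz => vertGrad_add_two_pi hper (z := z) hz
  have hg1 := hg.deriv hU
  have hgp1 := fun z hz => deriv_add_two_pi hgp (z := z) hz
  have hg2 := hg1.deriv hU
  have hgp2 := fun z hz => deriv_add_two_pi hgp1 (z := z) hz
  have hc1 := periodCoeff_complex_deriv hh0 hg hgp
  have hc2 := periodCoeff_complex_deriv hh0 hg1 hgp1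
  have hsq : ∀ n : ℤ, n ≠ 0 → 1 ≤ |(n : ℝ)| := fun n hn => by exact_mod_cast Int.one_le_abs hn
  have b0 := norm_sub_mean_le hh hJ hodd hpos hper (continuous_restrict_real hh0 hg)
    (periodic_restrict_real hh0 hgp) (fun n hn => by
      refine le_mul_of_one_le_left (norm_nonneg _) ?_
      nlinarith [hsq n hn]) x
  have b1 := norm_sub_mean_le hh hJ hodd hpos hper (continuous_restrict_real hh0 hg1)
    (periodic_restrict_real hh0 hgp1) (fun n hn => by
      rw [hc1 n, norm_mul, norm_mul, norm_I, mul_one, norm_intCast]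
      refine mul_le_mul_of_nonneg_right ?_ (norm_nonneg _)
      nlinarith [hsq n hn]) x
  have b2 := norm_sub_mean_le hh hJ hodd hpos hper (continuous_restrict_real hh0 hg2)
    (periodic_restrict_real hh0 hgp2) (fun n hn => by
      rw [hc2 n, hc1 n, norm_mul, norm_mul, norm_mul, norm_mul, norm_I, mul_one, norm_intCast,
        ← mul_assoc, ← sq]) x
  set A := (periodCoeff (fun x : ℝ => vertGrad J x) 0).re with hA
  set ε := (∑' n, coeffMajorant n) * (h * Real.exp (-h)) with hε
  have hε0 : 0 ≤ ε := mul_nonneg (tsum_nonneg coeffMajorant_nonneg) (by positivity)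
  have hre : ∀ w : ℂ, (2 * Real.pi * w).re = 2 * Real.pi * w.re := fun w => by
    rw [← re_ofReal_mul]
    push_cast
    rfl
  have hpi := Real.pi_pos
  have hA' : A ≤ 4 * Real.pi * pdy J x := by
    have h1 := (abs_le.1 ((abs_re_le_norm _).trans b0)).1
    rw [sub_re, hre, re_vertGrad, ← hA] at h1
    have hA0 : 0 ≤ A := by
      have hdecay := (norm_nonneg _).trans
        (norm_periodCoeff_vertGrad_le hh hJ hodd hpos hper one_ne_zero)
      exact nonneg_of_mul_nonneg_right hdecay
        (by simp only [Int.cast_one, abs_one]; positivity)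
    nlinarith
  have main : ∀ w : ℂ, ‖2 * Real.pi * w - 0‖ ≤ ε * A → |w.re| ≤ 2 * ε * pdy J x := by
    intro w hw
    rw [sub_zero] at hw
    have h1 := (abs_re_le_norm _).trans hw
    rw [hre, abs_mul, abs_of_pos (by positivity)] at h1
    have h2 := h1.trans (mul_le_mul_of_nonneg_left hA' hε0)
    refine le_of_mul_le_mul_left (h2.trans_eq ?_) (by positivity : 0 < 2 * Real.pi)
    ring
  have z1 : periodCoeff (fun x : ℝ => deriv (vertGrad J) x) 0 = 0 := by simp [hc1 0]
  have z2 : periodCoeff (fun x : ℝ => deriv (deriv (vertGrad J)) x) 0 = 0 := by simp [hc2 0]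
  rw [z1] at b1
  rw [z2] at b2
  exact ⟨main _ b1, main _ b2⟩

theorem antitoneOn_one_add_mul_exp_neg :
    AntitoneOn (fun h : ℝ => (1 + h) * Real.exp (-h)) (Set.Ioi 0) := by
  intro a ha b hb hab
  have ha' : 0 < a := ha
  have h1 : Real.exp (-a) = Real.exp (-b) * Real.exp (b - a) := by
    rw [← Real.exp_add]
    ring_nf
  have h2 := Real.add_one_le_exp (b - a)
  simp only
  rw [h1]
  have h3 : 1 + b ≤ (1 + a) * Real.exp (b - a) := by nlinarith
  nlinarith [Real.exp_pos (-b)]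

/-- The explicit nonincreasing bound, up to a multiplicative constant. -/
def boundProfile (h : ℝ) : ℝ := (1 + 1 / h ^ 2) * ((1 + h) * Real.exp (-h))

theorem boundProfile_pos {h : ℝ} (hh : 0 < h) : 0 < boundProfile h := by
  unfold boundProfile
  positivity

theorem antitoneOn_boundProfile : AntitoneOn boundProfile (Set.Ioi 0) := by
  intro a ha b hb hab
  have ha' : 0 < a := ha
  have hb' : 0 < b := hb
  refine mul_le_mul ?_ (antitoneOn_one_add_mul_exp_neg ha hb hab) (by positivity) (by positivity)
  gcongr

theorem isBigO_boundProfile :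
    boundProfile =O[atTop] fun h : ℝ => h * Real.exp (-h) := by
  refine Asymptotics.IsBigO.of_bound 4 ?_
  filter_upwards [eventually_ge_atTop 1] with h hh
  have hh0 : 0 < h := by linarith
  rw [Real.norm_of_nonneg (boundProfile_pos hh0).le, Real.norm_of_nonneg (by positivity)]
  have h1 : 1 + 1 / h ^ 2 ≤ 2 := by
    have : 1 / h ^ 2 ≤ 1 := div_le_one_of_le₀ (by nlinarith) (by positivity)
    linarith
  have h2 : 1 + h ≤ 2 * h := by linarith
  calc boundProfile h ≤ 2 * (2 * h * Real.exp (-h)) := by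
        unfold boundProfile
        gcongr
    _ = _ := by ring

/-- There are nonincreasing `S₁, S₂ : (0,∞) → (0,∞)` with
`S_j(h) = O(h·e^{−h})` as `h → ∞`, such that for every `h > 0` and every harmonic `J` on
`{|Im z| < h}` which is odd under conjugation, positive on the strip `0 < Im z < h`, and
`2π`-periodic, one has `|∂_x∂_y J(x)| ≤ S₁(h)·∂_y J(x)` and
`|∂_x²∂_y J(x)| ≤ S₂(h)·∂_y J(x)` for every real `x`. -/
theorem harmonic_log_derivative_bounds :
    ∃ S₁ S₂ : ℝ → ℝ,
      (∀ h > (0:ℝ), 0 < S₁ h) ∧ (∀ h > (0:ℝ), 0 < S₂ h) ∧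
      AntitoneOn S₁ (Set.Ioi 0) ∧ AntitoneOn S₂ (Set.Ioi 0) ∧
      Asymptotics.IsBigO Filter.atTop S₁ (fun h : ℝ => h * Real.exp (-h)) ∧
      Asymptotics.IsBigO Filter.atTop S₂ (fun h : ℝ => h * Real.exp (-h)) ∧
      ∀ h : ℝ, 0 < h → ∀ J : ℂ → ℝ,
        IsHarmonicOn J {z : ℂ | |z.im| < h} →
        (∀ z : ℂ, |z.im| < h → J ((starRingEnd ℂ) z) = -J z) →
        (∀ z : ℂ, 0 < z.im → z.im < h → 0 < J z) →
        (∀ z : ℂ, |z.im| < h → J (z + 2 * Real.pi) = J z) →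
        ∀ x : ℝ,
          |pdx (pdy J) (x : ℂ)| ≤ S₁ h * pdy J (x : ℂ) ∧
          |pdx (pdx (pdy J)) (x : ℂ)| ≤ S₂ h * pdy J (x : ℂ) := by
  set K := ∑' n, coeffMajorant n with hK
  have hK0 : 0 ≤ K := tsum_nonneg coeffMajorant_nonneg
  have hlim : Tendsto (fun h : ℝ => K * (h * Real.exp (-h))) atTop (𝓝 0) := by
    simpa using (Real.tendsto_pow_mul_exp_neg_atTop_nhds_zero 1).const_mul K
  obtain ⟨H, hH1, hH⟩ : ∃ H : ℝ, 1 < H ∧ ∀ h ≥ H, K * (h * Real.exp (-h)) ≤ 1 / 2 := by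
    obtain ⟨H, hH⟩ := eventually_atTop.1 (hlim.eventually_le_const one_half_pos)
    exact ⟨max H 2, lt_max_of_lt_right one_lt_two, fun h hh => hH h ((le_max_left _ _).trans hh)⟩
  set C := max (18 * Real.exp H) (2 * K) with hC
  have hC0 : 0 < C := lt_max_of_lt_left (by positivity)
  have hpos : ∀ h > (0 : ℝ), 0 < C * boundProfile h := fun h hh =>
    mul_pos hC0 (boundProfile_pos hh)
  have hanti : AntitoneOn (fun h => C * boundProfile h) (Set.Ioi 0) := fun a ha b hb hab =>
    mul_le_mul_of_nonneg_left (antitoneOn_boundProfile ha hb hab) hC0.le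
  have hO := isBigO_boundProfile.const_mul_left C
  refine ⟨fun h => C * boundProfile h, fun h => C * boundProfile h, hpos, hpos, hanti, hanti,
    hO, hO, ?_⟩
  intro h hh J hJ hodd hJpos hper x
  have hx : (x : ℂ) ∈ {z : ℂ | |z.im| < h} := by simpa using hh
  rw [pdx_pdy_eq (isOpen_strip h) hJ hx, pdx_pdx_pdy_eq (isOpen_strip h) hJ hx]
  have l0 := abs_re_iteratedDeriv_vertGrad_le hh hJ hodd hJpos x 0
  have l1 := abs_re_iteratedDeriv_vertGrad_le hh hJ hodd hJpos x 1
  have l2 := abs_re_iteratedDeriv_vertGrad_le hh hJ hodd hJpos x 2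
  rw [iteratedDeriv_one] at l1
  rw [iteratedDeriv_succ, iteratedDeriv_one] at l2
  norm_num [Nat.factorial] at l0 l1 l2
  have hy0 : 0 ≤ pdy J x := (abs_nonneg _).trans l0
  rcases lt_or_ge h H with hlt | hge
  · have hprofile : 18 * (1 + 1 / h ^ 2) ≤ C * boundProfile h := by
      have h1 : 18 ≤ C * Real.exp (-h) := by
        calc (18 : ℝ) = 18 * Real.exp H * Real.exp (-H) := by
              rw [mul_assoc, ← Real.exp_add]
              simp
          _ ≤ C * Real.exp (-h) := by
              gcongr
              exact le_max_left _ _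
      have h2 : 18 ≤ C * ((1 + h) * Real.exp (-h)) := by nlinarith
      calc 18 * (1 + 1 / h ^ 2) ≤ C * ((1 + h) * Real.exp (-h)) * (1 + 1 / h ^ 2) := by gcongr
        _ = C * boundProfile h := by
          rw [boundProfile]
          ring
    have hinv : 1 / h ≤ 1 + 1 / h ^ 2 := by
      have : 1 / h ^ 2 = (1 / h) ^ 2 := by rw [one_div_pow]
      rw [this]
      nlinarith [sq_nonneg (1 / h - 1)]
    have hinv0 : 0 < 1 / h := by positivity
    constructor
    · rw [← le_div_iff₀ hh] at l1
      refine l1.trans ?_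
      calc 4 * pdy J x / h = 4 * (1 / h) * pdy J x := by ring
        _ ≤ C * boundProfile h * pdy J x := by
          refine mul_le_mul_of_nonneg_right ?_ hy0
          linarith
    · rw [← le_div_iff₀ (by positivity)] at l2
      refine l2.trans ?_
      calc 18 * pdy J x / h ^ 2 = 18 * (1 / h ^ 2) * pdy J x := by ring
        _ ≤ C * boundProfile h * pdy J x := by
          refine mul_le_mul_of_nonneg_right ?_ hy0
          linarith
  · have hprofile : 2 * (K * (h * Real.exp (-h))) ≤ C * boundProfile h := by
      have h1 : h * Real.exp (-h) ≤ boundProfile h := by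
        rw [boundProfile]
        have h2 : h * Real.exp (-h) ≤ (1 + h) * Real.exp (-h) := by
          gcongr
          linarith
        refine h2.trans (le_mul_of_one_le_left (by positivity) ?_)
        have : 0 < 1 / h ^ 2 := by positivity
        linarith
      calc 2 * (K * (h * Real.exp (-h))) = 2 * K * (h * Real.exp (-h)) := by ring
        _ ≤ C * boundProfile h := by
          gcongr
          exact le_max_right _ _
    obtain ⟨t1, t2⟩ := abs_derivatives_le_of_thick (hH1.trans_le hge) (hH h hge) hJ hodd hJpos
      hper x
    exact ⟨t1.trans (mul_le_mul_of_nonneg_right hprofile hy0),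
      t2.trans (mul_le_mul_of_nonneg_right hprofile hy0)⟩
end
end

section
/- For every w ∈ ℂ with Im w > 0, one has −coth(Im w / 2) ≤ Im(cot(w/2)) ≤ −tanh(Im w / 2). -/
open Complex Topology

/-- The imaginary part of the complex cotangent in terms of real functions. -/
theorem im_cot_eq (z : ℂ) :
    (Complex.cot z).im = -(Real.sinh z.im * Real.cosh z.im /
      (Real.sin z.re ^ 2 + Real.sinh z.im ^ 2)) := by
  have hsin : Complex.sin z = ⟨Real.sin z.re * Real.cosh z.im, Real.cos z.re * Real.sinh z.im⟩ := by
    rw [Complex.sin_eq, Complex.mk_eq_add_mul_I]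
    push_cast
    rfl
  have hcos : Complex.cos z =
      ⟨Real.cos z.re * Real.cosh z.im, -(Real.sin z.re * Real.sinh z.im)⟩ := by
    rw [Complex.cos_eq, Complex.mk_eq_add_mul_I]
    push_cast
    ring
  have hnorm : Complex.normSq (Complex.sin z) = Real.sin z.re ^ 2 + Real.sinh z.im ^ 2 := by
    rw [hsin, Complex.normSq_mk]
    linear_combination Real.sin z.re ^ 2 * Real.cosh_sq z.im +
      Real.sinh z.im ^ 2 * Real.sin_sq_add_cos_sq z.re
  rw [Complex.cot_eq_cos_div_sin, Complex.div_im, hnorm, hsin, hcos, ← sub_div, ← neg_div]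
  congr 1
  linear_combination -Real.sinh z.im * Real.cosh z.im * Real.sin_sq_add_cos_sq z.re

/-- For every `w : ℂ` with `Im w > 0`,
`−coth(Im w / 2) ≤ Im(cot(w/2)) ≤ −tanh(Im w / 2)`,
where `coth x = cosh x / sinh x`. -/
theorem im_cot_half_bounds (w : ℂ) (hw : 0 < w.im) :
    -(Real.cosh (w.im / 2) / Real.sinh (w.im / 2)) ≤ (Complex.cot (w / 2)).im ∧
      (Complex.cot (w / 2)).im ≤ -Real.tanh (w.im / 2) := by
  have him : (w / 2).im = w.im / 2 := by simp
  rw [im_cot_eq, him, Real.tanh_eq_sinh_div_cosh, neg_le_neg_iff, neg_le_neg_iff]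
  have hS : 0 < Real.sinh (w.im / 2) := Real.sinh_pos_iff.mpr (half_pos hw)
  have hC : 0 < Real.cosh (w.im / 2) := Real.cosh_pos _
  have hN : 0 < Real.sin (w / 2).re ^ 2 + Real.sinh (w.im / 2) ^ 2 := by positivity
  constructor
  · rw [div_le_div_iff₀ hN hS]
    nlinarith [mul_nonneg hC.le (sq_nonneg (Real.sin (w / 2).re))]
  · rw [div_le_div_iff₀ hC hN]
    nlinarith [mul_le_mul_of_nonneg_left (Real.sin_sq_le_one (w / 2).re) hS.le,
      Real.cosh_sq (w.im / 2)]
end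

section
/- Let h > 0 and M ≥ 0, and let u be a bounded harmonic function on the strip S_h such that u(z) → 0 as z → x within S_h for every x ∈ ℝ, and limsup_{z → w, z ∈ S_h} |u(z)| ≤ M for every w ∈ ℂ with Im w = h. Then |u(z)| ≤ M·(Im z)/h for every z ∈ S_h. -/
open Complex Topology Filter Set

noncomputable section

/-- The second-order necessary condition at a local maximum, relative to a quadratic polynomial. -/
theorem deriv_deriv_le_of_isLocalMax_sub_quadratic {f : ℝ → ℝ} {a b c : ℝ}
    (hf : ContDiffAt ℝ 2 f 0)
    (hmax : IsLocalMax (fun t => f t - (a + b * t + c * t ^ 2)) 0) :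
    deriv (deriv f) 0 ≤ 2 * c := by
  set g : ℝ → ℝ := fun t => f t - (a + b * t + c * t ^ 2) with hg
  have hq : ∀ t : ℝ, HasDerivAt (fun t : ℝ => a + b * t + c * t ^ 2) (b + 2 * c * t) t := by
    intro t
    have := (((hasDerivAt_id t).const_mul b).const_add a).add
      (((hasDerivAt_id t).pow 2).const_mul c)
    refine this.congr_deriv ?_
    simp
    ring
  have hg1 : deriv g =ᶠ[𝓝 0] fun t => deriv f t - (b + 2 * c * t) := by
    filter_upwards [hf.eventually (by simp)] with t ht
    exact ((ht.differentiableAt (by simp)).hasDerivAt.sub (hq t)).deriv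
  have hf' : DifferentiableAt ℝ (deriv f) 0 :=
    (hf.derivWithin (m := 1) (by norm_num)).differentiableAt (by simp)
  have hg2 : deriv (deriv g) 0 = deriv (deriv f) 0 - 2 * c := by
    rw [hg1.deriv_eq]
    have hl : HasDerivAt (fun t : ℝ => b + 2 * c * t) (2 * c) 0 := by
      simpa using ((hasDerivAt_id (0 : ℝ)).const_mul (2 * c)).const_add b
    exact (hf'.hasDerivAt.sub hl).deriv
  by_contra! hlt
  have hpos : 0 < deriv (deriv g) 0 := by rw [hg2]; linarith
  have hcont : ContinuousAt g 0 := hf.continuousAt.sub (hq 0).continuousAt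
  have hmin := isLocalMin_of_deriv_deriv_pos hpos hmax.deriv_eq_zero hcont
  have hconst : g =ᶠ[𝓝 0] fun _ => g 0 := by
    filter_upwards [hmax, hmin] with t h1 h2 using le_antisymm h1 h2
  have hzero : deriv (deriv g) 0 = 0 := by
    have h1 : deriv g =ᶠ[𝓝 0] fun _ => 0 := by
      simpa using hconst.deriv
    rw [h1.deriv_eq]
    simp
  exact hpos.ne' hzero

theorem pdx_pdx_eq_deriv_deriv (u : ℂ → ℝ) (z : ℂ) :
    pdx (pdx u) z = deriv (deriv fun t : ℝ => u (z + t)) 0 := by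
  have h : (fun x : ℝ => pdx u (z + x)) = deriv fun t : ℝ => u (z + t) := by
    funext x
    simpa [pdx, add_assoc] using deriv_comp_const_add (fun t : ℝ => u (z + t)) x 0
  rw [← h, pdx]

theorem pdy_pdy_eq_deriv_deriv (u : ℂ → ℝ) (z : ℂ) :
    pdy (pdy u) z = deriv (deriv fun t : ℝ => u (z + t * I)) 0 := by
  have h : (fun y : ℝ => pdy u (z + y * I)) = deriv fun t : ℝ => u (z + t * I) := by
    funext y
    simpa [pdy, add_assoc, add_mul] using deriv_comp_const_add (fun t : ℝ => u (z + t * I)) y 0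
  rw [← h, pdy]

theorem IsHarmonicOn.neg {u : ℂ → ℝ} {U : Set ℂ} (hu : IsHarmonicOn u U) :
    IsHarmonicOn (fun z => -u z) U := by
  have hx : ∀ v : ℂ → ℝ, pdx (fun z => -v z) = fun z => -pdx v z := fun v => by
    funext z; simp [pdx]
  have hy : ∀ v : ℂ → ℝ, pdy (fun z => -v z) = fun z => -pdy v z := fun v => by
    funext z; simp [pdy]
  refine ⟨hu.1.neg, fun z hz => ?_⟩
  simp only [hx, hy]
  linarith [hu.2 z hz]

/-- A harmonic function minus a strictly superharmonic quadratic has no local maximum. -/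
theorem IsHarmonicOn.not_isLocalMax_sub {u : ℂ → ℝ} {U : Set ℂ} (hu : IsHarmonicOn u U)
    (hU : IsOpen U) {ε : ℝ} (hε : 0 < ε) (a k : ℝ) {z : ℂ} (hz : z ∈ U) :
    ¬ IsLocalMax (fun z : ℂ => u z - (a * z.im + ε * (z.re ^ 2 - 2 * z.im ^ 2 + k))) z := by
  intro hmax
  have hc : ContDiffAt ℝ 2 u z := hu.1.contDiffAt (hU.mem_nhds hz)
  have hx : pdx (pdx u) z ≤ 2 * ε := by
    rw [pdx_pdx_eq_deriv_deriv]
    have hl : ContDiffAt ℝ 2 (fun t : ℝ => z + (t : ℂ)) 0 :=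
      contDiffAt_const.add ofRealCLM.contDiff.contDiffAt
    refine deriv_deriv_le_of_isLocalMax_sub_quadratic
      (a := a * z.im + ε * (z.re ^ 2 - 2 * z.im ^ 2 + k)) (b := 2 * ε * z.re) ?_ ?_
    · exact ContDiffAt.comp (0 : ℝ) (by simpa using hc) hl
    · have ht : Tendsto (fun t : ℝ => z + (t : ℂ)) (𝓝 0) (𝓝 z) := by
        simpa using! hl.continuousAt.tendsto
      filter_upwards [ht.eventually hmax] with t ht
      simp at ht ⊢
      linarith
  have hy : pdy (pdy u) z ≤ 2 * (-2 * ε) := by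
    rw [pdy_pdy_eq_deriv_deriv]
    have hl : ContDiffAt ℝ 2 (fun t : ℝ => z + (t : ℂ) * I) 0 :=
      contDiffAt_const.add (ofRealCLM.contDiff.contDiffAt.mul contDiffAt_const)
    refine deriv_deriv_le_of_isLocalMax_sub_quadratic
      (a := a * z.im + ε * (z.re ^ 2 - 2 * z.im ^ 2 + k)) (b := a - 4 * ε * z.im) ?_ ?_
    · exact ContDiffAt.comp (0 : ℝ) (by simpa using hc) hl
    · have ht : Tendsto (fun t : ℝ => z + (t : ℂ) * I) (𝓝 0) (𝓝 z) := by
        simpa using! hl.continuousAt.tendsto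
      filter_upwards [ht.eventually hmax] with t ht
      simp at ht ⊢
      linarith
  linarith [hu.2 z hz]

/-- A harmonic function on a strip that is bounded above and is dominated by `a * Im z` on the
boundary is dominated by `a * Im z` inside. -/
theorem IsHarmonicOn.le_mul_im_of_strip {u : ℂ → ℝ} {h a B : ℝ}
    (hu : IsHarmonicOn u {z : ℂ | 0 < z.im ∧ z.im < h})
    (hB : ∀ z : ℂ, 0 < z.im → z.im < h → u z - a * z.im ≤ B)
    (hbdry : ∀ w : ℂ, w.im = 0 ∨ w.im = h → ∀ ε > (0 : ℝ),
      ∀ᶠ z in 𝓝[{z : ℂ | 0 < z.im ∧ z.im < h}] w, u z - a * z.im ≤ ε)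
    {z : ℂ} (hz0 : 0 < z.im) (hzh : z.im < h) : u z ≤ a * z.im := by
  set S : Set ℂ := {z : ℂ | 0 < z.im ∧ z.im < h} with hS
  have hSo : IsOpen S :=
    (isOpen_lt continuous_const continuous_im).inter (isOpen_lt continuous_im continuous_const)
  have key : ∀ ε > (0 : ℝ),
      u z - (a * z.im + ε * (z.re ^ 2 - 2 * z.im ^ 2 + (2 * h ^ 2 + 1))) ≤ 0 := by
    intro ε hε
    set v : ℂ → ℝ := fun z =>
      u z - (a * z.im + ε * (z.re ^ 2 - 2 * z.im ^ 2 + (2 * h ^ 2 + 1))) with hv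
    have hvle : ∀ w ∈ S, v w ≤ u w - a * w.im - ε * (w.re ^ 2 + 1) := by
      rintro w ⟨h1, h2⟩
      have : 0 ≤ ε * (h ^ 2 - w.im ^ 2) := mul_nonneg hε.le (by nlinarith)
      simp only [hv]
      linarith
    by_contra! hpos
    change 0 < v z at hpos
    have hvc : ContinuousOn v S := hu.1.continuousOn.sub (by fun_prop)
    set K : Set ℂ := {w | w ∈ S ∧ v z ≤ v w} with hK
    have hKclosed : IsClosed K := by
      rw [← isOpen_compl_iff, isOpen_iff_mem_nhds]
      intro w hw
      by_cases hwS : w ∈ S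
      · have hlt : v w < v z := not_le.1 fun hle => hw ⟨hwS, hle⟩
        filter_upwards [(hvc.continuousAt (hSo.mem_nhds hwS)).eventually_lt_const hlt] with y hy
        exact fun hyK => hyK.2.not_gt hy
      · by_cases hb : w.im = 0 ∨ w.im = h
        · filter_upwards [eventually_nhdsWithin_iff.1 (hbdry w hb ε hε)] with y hy hyK
          have := hvle y hyK.1
          nlinarith [hy hyK.1, hyK.2, mul_nonneg hε.le (sq_nonneg y.re)]
        · push Not at hb
          have hout : w.im < 0 ∨ h < w.im := by
            by_contra! hcon
            exact hwS ⟨lt_of_le_of_ne hcon.1 hb.1.symm, lt_of_le_of_ne hcon.2 hb.2⟩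
          rcases hout with hlt | hlt
          · filter_upwards [continuous_im.continuousAt.eventually_lt_const hlt] with y hy hyK
            exact lt_asymm hy hyK.1.1
          · filter_upwards [continuous_im.continuousAt.eventually_const_lt hlt] with y hy hyK
            exact lt_asymm hy hyK.1.2
    have hKsub : K ⊆ Icc (-(B / ε + 1)) (B / ε + 1) ×ℂ Icc 0 h := by
      rintro w ⟨hwS, hw⟩
      have h1 := hvle w hwS
      have h2 := hB w hwS.1 hwS.2
      have h3 : w.re ^ 2 + 1 ≤ B / ε := by
        rw [le_div_iff₀ hε]
        linarith
      exact ⟨abs_le.1 (abs_le_of_sq_le_sq (by nlinarith) (by nlinarith)), hwS.1.le, hwS.2.le⟩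
    have hKcompact : IsCompact K :=
      (isCompact_Icc.reProdIm isCompact_Icc).of_isClosed_subset hKclosed hKsub
    obtain ⟨w, hwK, hwmax⟩ := hKcompact.exists_isMaxOn ⟨z, ⟨hz0, hzh⟩, le_rfl⟩
      (hvc.mono fun _ hy => hy.1)
    refine hu.not_isLocalMax_sub hSo hε a (2 * h ^ 2 + 1) hwK.1 ?_
    filter_upwards [hSo.mem_nhds hwK.1] with y hy
    change v y ≤ v w
    rcases le_total (v z) (v y) with hle | hle
    · exact hwmax ⟨hy, hle⟩
    · exact hle.trans hwK.2
  have hlim : Tendsto (fun ε : ℝ =>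
      u z - (a * z.im + ε * (z.re ^ 2 - 2 * z.im ^ 2 + (2 * h ^ 2 + 1)))) (𝓝[>] 0)
      (𝓝 (u z - a * z.im)) := by
    refine Tendsto.mono_left ?_ nhdsWithin_le_nhds
    exact Continuous.tendsto' (by fun_prop) _ _ (by simp)
  exact sub_nonpos.1 (le_of_tendsto hlim (eventually_mem_nhdsWithin.mono key))

/-- Let `h > 0`, `M ≥ 0`, and let `u` be a bounded harmonic function on the
strip `S_h = {0 < Im z < h}` such that `u(z) → 0` as `z → x` within `S_h` for every real
`x`, and `limsup |u(z)| ≤ M` as `z → w` within `S_h` for every `w` with `Im w = h`. Then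
`|u(z)| ≤ M·(Im z)/h` on `S_h`. -/
theorem strip_harmonic_bound (h M : ℝ) (hh : 0 < h) (hM : 0 ≤ M)
    (u : ℂ → ℝ)
    (hu : IsHarmonicOn u {z : ℂ | 0 < z.im ∧ z.im < h})
    (hbd : ∃ B : ℝ, ∀ z : ℂ, 0 < z.im → z.im < h → |u z| ≤ B)
    (h0 : ∀ x : ℝ,
      Filter.Tendsto u (𝓝[{z : ℂ | 0 < z.im ∧ z.im < h}] (x : ℂ)) (𝓝 0))
    (htop : ∀ w : ℂ, w.im = h → ∀ ε > (0:ℝ),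
      ∀ᶠ z in 𝓝[{z : ℂ | 0 < z.im ∧ z.im < h}] w, |u z| ≤ M + ε) :
    ∀ z : ℂ, 0 < z.im → z.im < h → |u z| ≤ M * z.im / h := by
  obtain ⟨B, hB⟩ := hbd
  have hbdry : ∀ w : ℂ, w.im = 0 ∨ w.im = h → ∀ ε > (0 : ℝ),
      ∀ᶠ z in 𝓝[{z : ℂ | 0 < z.im ∧ z.im < h}] w, |u z| - M / h * z.im ≤ ε := by
    rintro w (hw | hw) ε hε
    · have hw' : ((w.re : ℝ) : ℂ) = w := Complex.ext (by simp) (by simp [hw])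
      have := (h0 w.re).abs.eventually_lt_const (by simpa using hε)
      rw [hw'] at this
      filter_upwards [this, self_mem_nhdsWithin] with z hz hzS
      have : 0 ≤ M / h * z.im := mul_nonneg (by positivity) hzS.1.le
      linarith
    · have hlt : M - ε / 2 < M / h * w.im := by
        rw [hw, div_mul_cancel₀ _ hh.ne']
        linarith
      have hc : ContinuousAt (fun z : ℂ => M / h * z.im) w := by fun_prop
      filter_upwards [htop w hw (ε / 2) (half_pos hε),
        nhdsWithin_le_nhds (hc.eventually_const_lt hlt)] with z hz1 hz2
      linarith
  have hbound : ∀ z : ℂ, 0 < z.im → z.im < h → |u z| - M / h * z.im ≤ B := by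
    intro z hz0 hzh
    have : 0 ≤ M / h * z.im := by positivity
    linarith [hB z hz0 hzh]
  intro z hz0 hzh
  rw [mul_div_right_comm, abs_le']
  constructor
  · exact hu.le_mul_im_of_strip
      (fun z h1 h2 => (sub_le_sub_right (le_abs_self _) _).trans (hbound z h1 h2))
      (fun w hw ε hε => (hbdry w hw ε hε).mono fun z hz =>
        (sub_le_sub_right (le_abs_self _) _).trans hz) hz0 hzh
  · exact hu.neg.le_mul_im_of_strip
      (fun z h1 h2 => (sub_le_sub_right (neg_le_abs _) _).trans (hbound z h1 h2))
      (fun w hw ε hε => (hbdry w hw ε hε).mono fun z hz =>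
        (sub_le_sub_right (neg_le_abs _) _).trans hz) hz0 hzh
end
end

section
/- Let ξ ∈ ℂ and let F be a holomorphic function on a neighborhood of ξ with F'(ξ) ≠ 0. Then F'(ξ)²·cot((F(w) − F(ξ))/2) − F'(w)·cot((w − ξ)/2) converges to −3·F''(ξ) as w → ξ with w ≠ ξ. -/
open Complex Topology Filter

theorem AnalyticAt.dslope_same {f : ℂ → ℂ} {a : ℂ} (hf : AnalyticAt ℂ f a) :
    AnalyticAt ℂ (dslope f a) a := by
  obtain ⟨p, hp⟩ := hf
  exact ⟨_, hp.has_fpower_series_dslope_fslope⟩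

theorem eq_add_mul_dslope (f : ℂ → ℂ) (a z : ℂ) : f z = f a + (z - a) * dslope f a z := by
  rw [← smul_eq_mul, sub_smul_dslope]
  ring

theorem AnalyticAt.eventually_deriv_eq_dslope_add {f : ℂ → ℂ} {a : ℂ} (hf : AnalyticAt ℂ f a) :
    ∀ᶠ z in 𝓝 a, deriv f z = dslope f a z + (z - a) * deriv (dslope f a) z := by
  filter_upwards [hf.dslope_same.eventually_analyticAt] with z hz
  have h : HasDerivAt (fun w => f a + (w - a) * dslope f a w)
      (1 * dslope f a z + (z - a) * deriv (dslope f a) z) z :=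
    (((hasDerivAt_id z).sub_const a).mul hz.differentiableAt.hasDerivAt).const_add (f a)
  rw [one_mul] at h
  rw [← h.deriv]
  congr 1
  exact funext (eq_add_mul_dslope f a)

theorem AnalyticAt.deriv_deriv_eq_two_mul_deriv_dslope {f : ℂ → ℂ} {a : ℂ}
    (hf : AnalyticAt ℂ f a) : deriv (deriv f) a = 2 * deriv (dslope f a) a := by
  have hG := hf.dslope_same
  have h := hG.differentiableAt.hasDerivAt.add
    (((hasDerivAt_id a).sub_const a).mul hG.deriv.differentiableAt.hasDerivAt)
  rw [Filter.EventuallyEq.deriv_eq hf.eventually_deriv_eq_dslope_add]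
  refine h.deriv.trans ?_
  simp
  ring

theorem Complex.tendsto_cot_sub_inv_nhdsNE_zero :
    Tendsto (fun z : ℂ => cot z - z⁻¹) (𝓝[≠] 0) (𝓝 0) := by
  have hsin : AnalyticAt ℂ sin 0 := differentiable_sin.analyticAt 0
  have hS := hsin.dslope_same
  have hS0 : dslope sin 0 (0 : ℂ) = 1 := by simp [dslope_same, Complex.deriv_sin]
  have hS' : deriv (dslope sin 0) (0 : ℂ) = 0 := by
    have h := hsin.deriv_deriv_eq_two_mul_deriv_dslope
    simpa [Complex.deriv_sin, Complex.deriv_cos'] using h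
  have hnum : HasDerivAt (fun z : ℂ => cos z - dslope sin 0 z) 0 0 := by
    simpa [hS'] using (hasDerivAt_cos 0).fun_sub hS.differentiableAt.hasDerivAt
  have hcont : Tendsto (dslope sin 0) (𝓝[≠] (0 : ℂ)) (𝓝 1) := by
    simpa [hS0] using hS.continuousAt.tendsto.mono_left nhdsWithin_le_nhds
  have hlim := hnum.tendsto_slope.div hcont one_ne_zero
  rw [zero_div] at hlim
  refine hlim.congr' ?_
  filter_upwards [self_mem_nhdsWithin, hcont.eventually_ne one_ne_zero] with z hz hSz
  have hz : z ≠ 0 := hz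
  have hsinz : sin z = z * dslope sin 0 z := by simpa using eq_add_mul_dslope sin 0 z
  rw [cot_eq_cos_div_sin, hsinz]
  simp only [Pi.div_apply, slope_def_field, hS0, cos_zero]
  field_simp
  ring

/-- If `F` is holomorphic on a neighborhood of `ξ` with `F'(ξ) ≠ 0`, then
`F'(ξ)²·cot((F(w) − F(ξ))/2) − F'(w)·cot((w − ξ)/2) → −3·F''(ξ)` as `w → ξ`, `w ≠ ξ`. -/
theorem cot_expansion_limit (ξ : ℂ) (F : ℂ → ℂ)
    (hF : ∀ᶠ z in 𝓝 ξ, DifferentiableAt ℂ F z)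
    (hF' : deriv F ξ ≠ 0) :
    Filter.Tendsto
      (fun w => (deriv F ξ) ^ 2 * Complex.cot ((F w - F ξ) / 2)
        - deriv F w * Complex.cot ((w - ξ) / 2))
      (𝓝[≠] ξ) (𝓝 (-3 * deriv (deriv F) ξ)) := by
  have hFa : AnalyticAt ℂ F ξ := analyticAt_iff_eventually_differentiableAt.mpr hF
  set G := dslope F ξ with hGdef
  have hG : AnalyticAt ℂ G ξ := hFa.dslope_same
  have hGξ : G ξ = deriv F ξ := dslope_same F ξ
  have hGlim : Tendsto G (𝓝[≠] ξ) (𝓝 (deriv F ξ)) :=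
    hGξ ▸ hG.continuousAt.tendsto.mono_left nhdsWithin_le_nhds
  have hG'lim : Tendsto (deriv G) (𝓝[≠] ξ) (𝓝 (deriv G ξ)) :=
    hG.deriv.continuousAt.tendsto.mono_left nhdsWithin_le_nhds
  have hF'lim : Tendsto (deriv F) (𝓝[≠] ξ) (𝓝 (deriv F ξ)) :=
    hFa.deriv.continuousAt.tendsto.mono_left nhdsWithin_le_nhds
  have hGne : ∀ᶠ w in 𝓝[≠] ξ, G w ≠ 0 := hGlim.eventually_ne hF'
  have hFG (w : ℂ) : F w - F ξ = (w - ξ) * G w := by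
    rw [eq_add_mul_dslope F ξ w, hGdef]
    ring
  have hne : ∀ᶠ w in 𝓝[≠] ξ, w - ξ ≠ 0 := by
    filter_upwards [self_mem_nhdsWithin] with w hw using sub_ne_zero.mpr hw
  have hz : Tendsto (fun w => (w - ξ) / 2) (𝓝[≠] ξ) (𝓝[≠] 0) := by
    refine tendsto_nhdsWithin_iff.mpr ⟨?_, ?_⟩
    · have h : ContinuousAt (fun w : ℂ => (w - ξ) / 2) ξ := by fun_prop
      simpa using h.tendsto.mono_left nhdsWithin_le_nhds
    · filter_upwards [hne] with w hw using div_ne_zero hw two_ne_zero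
  have hu : Tendsto (fun w => (F w - F ξ) / 2) (𝓝[≠] ξ) (𝓝[≠] 0) := by
    refine tendsto_nhdsWithin_iff.mpr ⟨?_, ?_⟩
    · have h : ContinuousAt (fun w : ℂ => (F w - F ξ) / 2) ξ :=
        (hFa.continuousAt.sub continuousAt_const).div_const 2
      simpa using h.tendsto.mono_left nhdsWithin_le_nhds
    · filter_upwards [hne, hGne] with w hw hGw
      rw [hFG]
      exact div_ne_zero (mul_ne_zero hw hGw) two_ne_zero
  have hlim := (((tendsto_cot_sub_inv_nhdsNE_zero.comp hu).const_mul (deriv F ξ ^ 2)).sub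
    (hF'lim.mul (tendsto_cot_sub_inv_nhdsNE_zero.comp hz))).add
    (((hG.differentiableAt.hasDerivAt.tendsto_slope.mul
      (hGlim.const_add (deriv F ξ))).div hGlim hF').const_mul (-2) |>.sub (hG'lim.const_mul 2))
  have hval : deriv F ξ ^ 2 * 0 - deriv F ξ * 0 +
      (-2 * (deriv G ξ * (deriv F ξ + deriv F ξ) / deriv F ξ) - 2 * deriv G ξ)
      = -3 * deriv (deriv F) ξ := by
    rw [hFa.deriv_deriv_eq_two_mul_deriv_dslope]
    field_simp
    ring
  rw [hval] at hlim
  refine hlim.congr' ?_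
  filter_upwards [hne, hGne,
    hFa.eventually_deriv_eq_dslope_add.filter_mono nhdsWithin_le_nhds] with w hw hGw hd
  simp only [Function.comp_apply, Pi.div_apply, slope_def_field, hGξ, hFG]
  rw [hd, ← hGdef]
  field_simp
  ring
end
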